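/- arXiv:2002.08894 — 4 statements merged into one kernel-verified Lean document; each statement's English description precedes it below -/
import Mathlib

section
/- Let X and Y be finite subsets of ℝ and let M be a pointwise finite-dimensional persistence module over the product poset X × Y. Then M is rectangle-decomposable if and only if M is weakly exact. -/
open CategoryTheory Limits Set

noncomputable section

set_option linter.unusedSectionVars false

attribute [local instance] Classical.propDecidable

namespace PersistencePaper

/-- A persistence module over a poset `P`, with coefficients in a field `k`:
a functor from `P` (viewed as a category) to the category of `k`-vector spaces. -/
abbrev PersistenceModule (k : Type) [Field k] (P : Type) [Preorder P] : Type 1 :=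
  P ⥤ ModuleCat k

variable (k : Type) [Field k]

section Indicator

variable {P : Type} [Preorder P]

/-- The fiber of the indicator module of a set `Q ⊆ P` at a point `t : P`,
realized as a submodule of `k`: it is all of `k` when `t ∈ Q` and `0` otherwise. -/
def indSub (Q : Set P) (t : P) : Submodule k k where
  carrier := {x | t ∉ Q → x = 0}
  add_mem' := by intro a b ha hb ht; rw [ha ht, hb ht, add_zero]
  zero_mem' := fun _ => rfl
  smul_mem' := by intro c x hx ht; rw [hx ht, smul_zero]

/-- The structure map of the indicator module: the identity when both endpoints lie in
`Q`, and zero otherwise. -/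
def indMap (Q : Set P) (s t : P) : indSub k Q s →ₗ[k] indSub k Q t where
  toFun x := ⟨if s ∈ Q ∧ t ∈ Q then (x : k) else 0, by
    intro ht
    split_ifs with h
    · exact absurd h.2 ht
    · rfl⟩
  map_add' x y := by apply Subtype.ext; split_ifs <;> simp
  map_smul' c x := by apply Subtype.ext; split_ifs <;> simp

theorem indMap_coe (Q : Set P) (s t : P) (x : indSub k Q s) :
    (indMap k Q s t x : k) = if s ∈ Q ∧ t ∈ Q then (x : k) else 0 := rfl

/-- The indicator persistence module `k_Q` of a convex subset `Q` of a poset `P`: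
it assigns `k` to points of `Q` and `0` elsewhere, the structure maps being the identity
between points of `Q` and zero otherwise. -/
def indicator (Q : Set P) (hQ : Q.OrdConnected) : PersistenceModule k P where
  obj t := ModuleCat.of k (indSub k Q t)
  map {s t} _ := ModuleCat.ofHom (indMap k Q s t)
  map_id t := by
    refine ModuleCat.hom_ext (LinearMap.ext fun x => Subtype.ext ?_)
    show (indMap k Q t t x).val = Subtype.val x
    rw [indMap_coe]
    split_ifs with h
    · rfl
    · exact (x.2 fun ht => h ⟨ht, ht⟩).symm
  map_comp {s t u} f g := by
    refine ModuleCat.hom_ext (LinearMap.ext fun x => Subtype.ext ?_)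
    show (indMap k Q s u x).val = (indMap k Q t u (indMap k Q s t x)).val
    rw [indMap_coe, indMap_coe, indMap_coe]
    by_cases hs : s ∈ Q <;> by_cases hu : u ∈ Q
    · have ht : t ∈ Q := hQ.out hs hu ⟨leOfHom f, leOfHom g⟩
      simp [hs, ht, hu]
    · simp [hs, hu]
    · simp [hs, hu]
    · simp [hs, hu]

/-- The structure map `ρ_s^t : M_s → M_t` of a persistence module, as a linear map. -/
def rho (M : PersistenceModule k P) {s t : P} (h : s ≤ t) : M.obj s →ₗ[k] M.obj t :=
  (M.map (homOfLE h)).hom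

/-- The rank invariant `r(s,t)` of a persistence module: the rank of `ρ_s^t` when `s ≤ t`,
and `0` (by convention) otherwise. -/
def rk (M : PersistenceModule k P) (s t : P) : ℕ :=
  if h : s ≤ t then Module.finrank k (LinearMap.range (rho k M h)) else 0

/-- A persistence module is pointwise finite-dimensional (pfd) if all its spaces are
finite-dimensional. -/
def Pfd (M : PersistenceModule k P) : Prop :=
  ∀ t : P, FiniteDimensional k (M.obj t)

/-- An interval of a poset: a nonempty, convex and zigzag-connected subset. -/
def IsInterval (Q : Set P) : Prop :=
  Q.Nonempty ∧ Q.OrdConnected ∧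
    ∀ p ∈ Q, ∀ q ∈ Q,
      Relation.ReflTransGen (fun a b => a ∈ Q ∧ b ∈ Q ∧ (a ≤ b ∨ b ≤ a)) p q

/-- A persistence module is interval-decomposable if it is isomorphic to a direct sum
of indicator modules of intervals. -/
def IntervalDecomposable (M : PersistenceModule k P) : Prop :=
  ∃ (ι : Type) (I : ι → Set P) (hI : ∀ i, IsInterval (I i)),
    Nonempty (M ≅ ∐ fun i => indicator k (I i) (hI i).2.1)

end Indicator

section Rect

variable {X Y : Type} [Preorder X] [Preorder Y]

/-- A rectangle in the product poset `X × Y`: a nonempty product `I ×ˢ J` of an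
interval (convex subset) of `X` with an interval of `Y`. -/
def IsRectangle (R : Set (X × Y)) : Prop :=
  R.Nonempty ∧ ∃ (I : Set X) (J : Set Y), I.OrdConnected ∧ J.OrdConnected ∧ R = I ×ˢ J

theorem IsRectangle.ordConnected {R : Set (X × Y)} (h : IsRectangle R) :
    R.OrdConnected := by
  obtain ⟨-, I, J, hI, hJ, rfl⟩ := h
  constructor
  intro x hx y hy z hz
  exact ⟨hI.out hx.1 hy.1 ⟨hz.1.1, hz.2.1⟩, hJ.out hx.2 hy.2 ⟨hz.1.2, hz.2.2⟩⟩

/-- A persistence bimodule is rectangle-decomposable if it is isomorphic to a direct sum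
of indicator (rectangle) modules of rectangles. -/
def RectangleDecomposable (M : PersistenceModule k (X × Y)) : Prop :=
  ∃ (ι : Type) (R : ι → Set (X × Y)) (hR : ∀ i, IsRectangle (R i)),
    Nonempty (M ≅ ∐ fun i => indicator k (R i) (hR i).ordConnected)

/-- A persistence bimodule `M` over `X × Y` is weakly exact if for all `s ≤ t`,
`Im ρ_s^t = Im ρ_{(t₁,s₂)}^t ∩ Im ρ_{(s₁,t₂)}^t` and
`Ker ρ_s^t = Ker ρ_s^{(t₁,s₂)} + Ker ρ_s^{(s₁,t₂)}`. -/
def WeaklyExact (M : PersistenceModule k (X × Y)) : Prop :=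
  ∀ (s t : X × Y) (h : s ≤ t),
    (LinearMap.range (rho k M h) =
        LinearMap.range (rho k M (show (t.1, s.2) ≤ t from ⟨le_refl t.1, h.2⟩)) ⊓
        LinearMap.range (rho k M (show (s.1, t.2) ≤ t from ⟨h.1, le_refl t.2⟩))) ∧
    (LinearMap.ker (rho k M h) =
        LinearMap.ker (rho k M (show s ≤ (t.1, s.2) from ⟨h.1, le_refl s.2⟩)) ⊔
        LinearMap.ker (rho k M (show s ≤ (s.1, t.2) from ⟨le_refl s.1, h.2⟩)))

/-- The space (fiber) of a persistence module at an index. -/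
abbrev fiber {k : Type} [Field k] {P : Type} [Preorder P]
    (M : PersistenceModule k P) (t : P) : ModuleCat k :=
  M.obj t

/-- Morphisms of persistence modules (natural transformations). -/
abbrev PMHom {k : Type} [Field k] {P : Type} [Preorder P]
    (M N : PersistenceModule k P) : Type :=
  M ⟶ N

/-- The component of a morphism of persistence modules at an index, as a linear map. -/
abbrev PMHom.appLin {k : Type} [Field k] {P : Type} [Preorder P]
    {M N : PersistenceModule k P} (f : PMHom M N) (t : P) :
    M.obj t →ₗ[k] N.obj t :=
  (f.app t).hom

/-- The restriction of a persistence module to a subset of its indexing poset. -/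
def restrict {P : Type} [Preorder P] (M : PersistenceModule k P) (S : Set P) :
    PersistenceModule k ↥S :=
  (show Monotone (Subtype.val : ↥S → P) from fun _ _ h => h).functor ⋙ M

/-- The pullback (restriction) of a persistence module along a monotone map of posets. -/
def restrictAlong {P R : Type} [Preorder P] [Preorder R] {f : R → P} (hf : Monotone f)
    (M : PersistenceModule k P) : PersistenceModule k R :=
  hf.functor ⋙ M

/-- The right Kan extension of a persistence module along a monotone map of posets. -/
def ranAlong {P R : Type} [Preorder P] [Preorder R] {f : P → R} (hf : Monotone f)
    (M : PersistenceModule k P) : PersistenceModule k R :=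
  hf.functor.ran.obj M

/-- `M` decomposes as a direct sum of indicator modules whose supports are drawn from
the family `A` of (convex) subsets of the indexing poset. -/
def DecomposesWithSupports {P : Type} [Preorder P] (M : PersistenceModule k P)
    (A : Set (Set P)) : Prop :=
  ∃ (ι : Type) (Q : ι → Set P) (_ : ∀ i, Q i ∈ A) (hconv : ∀ i, (Q i).OrdConnected),
    Nonempty (M ≅ ∐ fun i => indicator k (Q i) (hconv i))

end Rect

end PersistencePaper
namespace PersistencePaper

section Aux

variable {k : Type} [Field k] {P : Type} [Preorder P]

theorem rho_trans (M : PersistenceModule k P) {s t u : P} (h : s ≤ t) (h' : t ≤ u)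
    (x : M.obj s) : rho k M h' (rho k M h x) = rho k M (h.trans h') x := by
  have : M.map (homOfLE (h.trans h')) = M.map (homOfLE h) ≫ M.map (homOfLE h') := by
    rw [← M.map_comp]; rfl
  simp only [rho, this, ModuleCat.hom_comp, LinearMap.comp_apply]

theorem rho_self (M : PersistenceModule k P) {s : P} (h : s ≤ s)
    (x : M.obj s) : rho k M h x = x := by
  have : M.map (homOfLE h) = 𝟙 _ := M.map_id s
  simp only [rho, this]; rfl

theorem rho_nat {M N : PersistenceModule k P} (f : M ⟶ N) {s t : P} (h : s ≤ t)
    (x : M.obj s) : rho k N h ((f.app s).hom x) = (f.app t).hom (rho k M h x) := by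
  have := f.naturality (homOfLE h)
  exact (LinearMap.congr_fun (congrArg ModuleCat.Hom.hom this) x).symm

theorem retract_app {M N : PersistenceModule k P} (i : N ⟶ M) (r : M ⟶ N) (h : i ≫ r = 𝟙 N)
    (t : P) (x : N.obj t) : (r.app t).hom ((i.app t).hom x) = x := by
  have h2 : i.app t ≫ r.app t = 𝟙 _ := by rw [← NatTrans.comp_app, h]; rfl
  exact LinearMap.congr_fun (congrArg ModuleCat.Hom.hom h2) x

/-- inclusion of an indicator module, pointwise -/
def inclLin (M : PersistenceModule k P) (s0 t0 : P) (v : M.obj s0) (t : P) :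
    indSub k (Icc s0 t0) t →ₗ[k] M.obj t :=
  if h : s0 ≤ t then
    (LinearMap.toSpanSingleton k (M.obj t) (rho k M h v)).comp
      (indSub k (Icc s0 t0) t).subtype else 0

theorem inclLin_pos (M : PersistenceModule k P) (s0 t0 : P) (v : M.obj s0) (t : P) (h : s0 ≤ t)
    (x : indSub k (Icc s0 t0) t) : inclLin M s0 t0 v t x = (x : k) • rho k M h v := by
  simp [inclLin, h]

theorem inclLin_nat (M : PersistenceModule k P) (s0 t0 : P) (v : M.obj s0)
    (hv : ∀ t (h : s0 ≤ t), t ∉ Icc s0 t0 → rho k M h v = 0) {s t : P} (hst : s ≤ t)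
    (x : indSub k (Icc s0 t0) s) :
    inclLin M s0 t0 v t (indMap k (Icc s0 t0) s t x) = rho k M hst (inclLin M s0 t0 v s x) := by
  by_cases hs : s ∈ Icc s0 t0
  · have h1 : s0 ≤ t := hs.1.trans hst
    rw [inclLin_pos _ _ _ _ _ h1, inclLin_pos _ _ _ _ _ hs.1, map_smul, rho_trans, indMap_coe]
    by_cases ht : t ∈ Icc s0 t0
    · rw [if_pos ⟨hs, ht⟩]
    · rw [hv t h1 ht]; simp
  · have hx : x = 0 := Subtype.ext (x.2 hs)
    rw [hx]; simp

/-- inclusion of an indicator module -/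
def incl (M : PersistenceModule k P) (s0 t0 : P) (v : M.obj s0)
    (hv : ∀ t (h : s0 ≤ t), t ∉ Icc s0 t0 → rho k M h v = 0) :
    indicator k (Icc s0 t0) ordConnected_Icc ⟶ M where
  app t := ModuleCat.ofHom (inclLin M s0 t0 v t)
  naturality s t f := by
    refine ModuleCat.hom_ext (LinearMap.ext fun x => ?_)
    exact inclLin_nat M s0 t0 v hv (leOfHom f) x

/-- projection to an indicator module, pointwise -/
def projLin (M : PersistenceModule k P) (t0 : P) (φ : M.obj t0 →ₗ[k] k) (t : P) :
    M.obj t →ₗ[k] k := if h : t ≤ t0 then φ.comp (rho k M h) else 0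

theorem projLin_pos (M : PersistenceModule k P) (t0 : P) (φ : M.obj t0 →ₗ[k] k) (t : P)
    (h : t ≤ t0) (x : M.obj t) : projLin M t0 φ t x = φ (rho k M h x) := by
  simp [projLin, h]

theorem projLin_mem (M : PersistenceModule k P) (s0 t0 : P) (φ : M.obj t0 →ₗ[k] k)
    (hφ : ∀ t (h : t ≤ t0), t ∉ Icc s0 t0 → ∀ m, φ (rho k M h m) = 0) (t : P) (m : M.obj t) :
    projLin M t0 φ t m ∈ indSub k (Icc s0 t0) t := by
  intro ht
  by_cases h : t ≤ t0
  · rw [projLin_pos _ _ _ _ h]; exact hφ t h ht m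
  · simp [projLin, h]

theorem projLin_nat (M : PersistenceModule k P) (s0 t0 : P) (φ : M.obj t0 →ₗ[k] k)
    (hφ : ∀ t (h : t ≤ t0), t ∉ Icc s0 t0 → ∀ m, φ (rho k M h m) = 0) {s t : P} (hst : s ≤ t)
    (x : M.obj s) :
    projLin M t0 φ t (rho k M hst x) =
      (indMap k (Icc s0 t0) s t ⟨projLin M t0 φ s x, projLin_mem M s0 t0 φ hφ s x⟩ : k) := by
  rw [indMap_coe]
  by_cases ht : t ≤ t0
  · rw [projLin_pos _ _ _ _ ht, rho_trans]
    by_cases hs : s ∈ Icc s0 t0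
    · rw [if_pos ⟨hs, hs.1.trans hst, ht⟩]
      exact (projLin_pos _ _ _ _ (hst.trans ht) _).symm
    · rw [if_neg (fun h => hs h.1), hφ s _ hs]
  · rw [if_neg (fun h => ht h.2.2)]
    simp [projLin, ht]

/-- projection to an indicator module -/
def proj (M : PersistenceModule k P) (s0 t0 : P) (φ : M.obj t0 →ₗ[k] k)
    (hφ : ∀ t (h : t ≤ t0), t ∉ Icc s0 t0 → ∀ m, φ (rho k M h m) = 0) :
    M ⟶ indicator k (Icc s0 t0) ordConnected_Icc where
  app t := ModuleCat.ofHom (LinearMap.codRestrict (indSub k (Icc s0 t0) t)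
    (projLin M t0 φ t) (projLin_mem M s0 t0 φ hφ t))
  naturality s t f := by
    refine ModuleCat.hom_ext (LinearMap.ext fun x => Subtype.ext ?_)
    exact projLin_nat M s0 t0 φ hφ (leOfHom f) x

theorem incl_proj_lin (M : PersistenceModule k P) (s0 t0 : P) (h0 : s0 ≤ t0) (v : M.obj s0)
    (φ : M.obj t0 →ₗ[k] k) (h1 : φ (rho k M h0 v) = 1) (t : P) (x : indSub k (Icc s0 t0) t) :
    projLin M t0 φ t (inclLin M s0 t0 v t x) = x := by
  by_cases ht : t ∈ Icc s0 t0
  · rw [inclLin_pos _ _ _ _ _ ht.1, projLin_pos _ _ _ _ ht.2]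
    simp [rho_trans, h1]
  · have hx : x = 0 := Subtype.ext (x.2 ht)
    rw [hx]; simp

theorem incl_proj (M : PersistenceModule k P) (s0 t0 : P) (h0 : s0 ≤ t0) (v : M.obj s0)
    (hv : ∀ t (h : s0 ≤ t), t ∉ Icc s0 t0 → rho k M h v = 0)
    (φ : M.obj t0 →ₗ[k] k)
    (hφ : ∀ t (h : t ≤ t0), t ∉ Icc s0 t0 → ∀ m, φ (rho k M h m) = 0)
    (h1 : φ (rho k M h0 v) = 1) :
    incl M s0 t0 v hv ≫ proj M s0 t0 φ hφ = 𝟙 _ := by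
  apply NatTrans.ext; funext t
  refine ModuleCat.hom_ext (LinearMap.ext fun x => Subtype.ext ?_)
  exact incl_proj_lin M s0 t0 h0 v φ h1 t x

theorem proj_app_ne (M : PersistenceModule k P) (s0 t0 : P) (h0 : s0 ≤ t0) (v : M.obj s0)
    (φ : M.obj t0 →ₗ[k] k)
    (hφ : ∀ t (h : t ≤ t0), t ∉ Icc s0 t0 → ∀ m, φ (rho k M h m) = 0)
    (h1 : φ (rho k M h0 v) = 1) :
    PMHom.appLin (proj M s0 t0 φ hφ) s0 v ≠ 0 := by
  intro h5
  have h6 : projLin M t0 φ s0 v = 0 := congrArg Subtype.val h5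
  rw [projLin_pos _ _ _ _ h0, h1] at h6
  exact one_ne_zero h6

/-- the structure map of the direct sum -/
def dmap (k : Type) [Field k] {ι : Type} (Q : ι → Set P) (s t : P) :
    (Π₀ i, indSub k (Q i) s) →ₗ[k] (Π₀ i, indSub k (Q i) t) :=
  DFinsupp.mapRange.linearMap fun i => indMap k (Q i) s t

theorem dmap_apply {ι : Type} (Q : ι → Set P) (s t : P) (x : Π₀ i, indSub k (Q i) s) (i : ι) :
    ((dmap k Q s t x i : indSub k (Q i) t) : k) =
      if s ∈ Q i ∧ t ∈ Q i then (x i : k) else 0 := rfl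

theorem dmap_single {ι : Type} (Q : ι → Set P) (s t : P) (i : ι) (x : indSub k (Q i) s) :
    dmap k Q s t (DFinsupp.single i x) = DFinsupp.single i (indMap k (Q i) s t x) := by
  simp [dmap]

/-- explicit direct sum -/
def dsum {ι : Type} (Q : ι → Set P) (hQ : ∀ i, (Q i).OrdConnected) :
    PersistenceModule k P where
  obj t := ModuleCat.of k (Π₀ i, indSub k (Q i) t)
  map {s t} _ := ModuleCat.ofHom (dmap k Q s t)
  map_id t := by
    refine ModuleCat.hom_ext (LinearMap.ext fun x => ?_)
    refine DFinsupp.ext fun i => ?_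
    exact LinearMap.congr_fun (congrArg ModuleCat.Hom.hom ((indicator k (Q i) (hQ i)).map_id t))
      (x i)
  map_comp {s t u} f g := by
    refine ModuleCat.hom_ext (LinearMap.ext fun x => ?_)
    refine DFinsupp.ext fun i => ?_
    exact LinearMap.congr_fun (congrArg ModuleCat.Hom.hom
      ((indicator k (Q i) (hQ i)).map_comp f g)) (x i)

def dsumInj {ι : Type} (Q : ι → Set P) (hQ : ∀ i, (Q i).OrdConnected) (i : ι) :
    indicator k (Q i) (hQ i) ⟶ dsum Q hQ where
  app t := ModuleCat.ofHom (Y := Π₀ i, indSub k (Q i) t)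
    (DFinsupp.lsingle (R := k) (M := fun i => indSub k (Q i) t) i)
  naturality s t f := by
    refine ModuleCat.hom_ext (LinearMap.ext fun x => ?_)
    exact (dmap_single Q s t i x).symm

/-- descent, pointwise -/
def descLin {ι : Type} (Q : ι → Set P) (t : P) (V : Type) [AddCommGroup V] [Module k V]
    (g : ∀ i, indSub k (Q i) t →ₗ[k] V) : (Π₀ i, indSub k (Q i) t) →ₗ[k] V :=
  DFinsupp.lsum ℕ g

theorem descLin_single {ι : Type} (Q : ι → Set P) (t : P) (V : Type) [AddCommGroup V] [Module k V]
    (g : ∀ i, indSub k (Q i) t →ₗ[k] V) (i : ι) (x : indSub k (Q i) t) :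
    descLin Q t V g (DFinsupp.single i x) = g i x :=
  DFinsupp.lsum_single _ _ _ _

def dsumDesc {ι : Type} (Q : ι → Set P) (hQ : ∀ i, (Q i).OrdConnected)
    (N : PersistenceModule k P) (g : ∀ i, indicator k (Q i) (hQ i) ⟶ N) :
    dsum Q hQ ⟶ N where
  app t := ModuleCat.ofHom (X := Π₀ i, indSub k (Q i) t) (Y := N.obj t)
    (descLin Q t (N.obj t) (fun i => ((g i).app t).hom))
  naturality s t f := by
    refine ModuleCat.hom_ext ?_
    refine DFinsupp.lhom_ext fun i x => ?_
    have e1 : descLin Q t (N.obj t) (fun i => ((g i).app t).hom)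
        (dmap k Q s t (DFinsupp.single i x)) = ((g i).app t).hom (indMap k (Q i) s t x) := by
      rw [dmap_single]; exact descLin_single _ _ _ _ _ _
    have e2 : (N.map f).hom (descLin Q s (N.obj s) (fun i => ((g i).app s).hom)
        (DFinsupp.single i x)) = (N.map f).hom (((g i).app s).hom x) :=
      congrArg _ (descLin_single _ _ _ _ _ _)
    refine Eq.trans e1 (Eq.trans ?_ e2.symm)
    exact LinearMap.congr_fun (congrArg ModuleCat.Hom.hom ((g i).naturality f)) x

def dsumIsColimit {ι : Type} (Q : ι → Set P) (hQ : ∀ i, (Q i).OrdConnected) :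
    IsColimit (Cofan.mk (dsum (k := k) Q hQ) (dsumInj Q hQ)) :=
  Cofan.IsColimit.mk _ (fun s => dsumDesc Q hQ s.pt s.inj)
    (by
      intro s i
      apply NatTrans.ext; funext t
      refine ModuleCat.hom_ext (LinearMap.ext fun x => ?_)
      exact descLin_single Q t (s.pt.obj t) (fun i => ((s.inj i).app t).hom) i x)
    (by
      intro s m hm
      apply NatTrans.ext; funext t
      refine ModuleCat.hom_ext ?_
      refine DFinsupp.lhom_ext fun i x => ?_
      refine Eq.trans ?_
        (descLin_single Q t (s.pt.obj t) (fun i => ((s.inj i).app t).hom) i x).symm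
      exact LinearMap.congr_fun (congrArg (fun z => PMHom.appLin z t) (hm i)) x)

end Aux

section Main

variable {k : Type} [Field k]

theorem weaklyExact_retract {X Y : Type} [Preorder X] [Preorder Y]
    {M N : PersistenceModule k (X × Y)} (i : N ⟶ M) (r : M ⟶ N) (h : i ≫ r = 𝟙 N)
    (hM : WeaklyExact k M) : WeaklyExact k N := by
  intro s t hst
  obtain ⟨h1, h2⟩ := hM s t hst
  constructor
  · apply le_antisymm
    · rintro _ ⟨x, rfl⟩
      exact ⟨⟨rho k N (show s ≤ (t.1, s.2) from ⟨hst.1, le_refl s.2⟩) x, rho_trans N _ _ x⟩,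
        ⟨rho k N (show s ≤ (s.1, t.2) from ⟨le_refl s.1, hst.2⟩) x, rho_trans N _ _ x⟩⟩
    · rintro x ⟨⟨y, hy⟩, ⟨z, hz⟩⟩
      have : PMHom.appLin i t x ∈ LinearMap.range (rho k M hst) := by
        rw [h1]
        exact ⟨⟨PMHom.appLin i _ y, by rw [rho_nat, hy]⟩, ⟨PMHom.appLin i _ z, by rw [rho_nat, hz]⟩⟩
      obtain ⟨w, hw⟩ := this
      exact ⟨PMHom.appLin r s w, by rw [rho_nat, hw, retract_app i r h]⟩
  · apply le_antisymm
    · intro x hx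
      have : PMHom.appLin i s x ∈ LinearMap.ker (rho k M hst) := by
        rw [LinearMap.mem_ker] at hx ⊢
        rw [rho_nat, hx, map_zero]
      rw [h2] at this
      obtain ⟨u, hu, w, hw, huw⟩ := Submodule.mem_sup.1 this
      refine Submodule.mem_sup.2 ⟨PMHom.appLin r s u, ?_, PMHom.appLin r s w, ?_, ?_⟩
      · rw [LinearMap.mem_ker] at hu ⊢
        rw [rho_nat, hu, map_zero]
      · rw [LinearMap.mem_ker] at hw ⊢
        rw [rho_nat, hw, map_zero]
      · rw [← map_add, huw, retract_app i r h]
    · refine sup_le ?_ ?_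
      · intro x hx
        rw [LinearMap.mem_ker] at hx ⊢
        rw [← rho_trans N (show s ≤ (t.1, s.2) from ⟨hst.1, le_refl s.2⟩)
          (show (t.1, s.2) ≤ t from ⟨le_refl t.1, hst.2⟩), hx, map_zero]
      · intro x hx
        rw [LinearMap.mem_ker] at hx ⊢
        rw [← rho_trans N (show s ≤ (s.1, t.2) from ⟨le_refl s.1, hst.2⟩)
          (show (s.1, t.2) ≤ t from ⟨hst.1, le_refl t.2⟩), hx, map_zero]

theorem dsum_weaklyExact {X Y : Type} [Preorder X] [Preorder Y] {ι : Type}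
    (Q : ι → Set (X × Y)) (hR : ∀ i, IsRectangle (Q i)) :
    WeaklyExact k (dsum (k := k) Q fun i => (hR i).ordConnected) := by
  have key : ∀ i (s t : X × Y), ((t.1, s.2) ∈ Q i ∧ (s.1, t.2) ∈ Q i) ↔ (s ∈ Q i ∧ t ∈ Q i) := by
    intro i s t
    obtain ⟨-, I, J, -, -, h⟩ := hR i
    rw [h]; simp only [mem_prod]; tauto
  intro s t hst
  constructor
  · apply le_antisymm
    · rintro _ ⟨x, rfl⟩
      exact ⟨⟨rho k _ (show s ≤ (t.1, s.2) from ⟨hst.1, le_refl s.2⟩) x, rho_trans _ _ _ x⟩,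
        ⟨rho k _ (show s ≤ (s.1, t.2) from ⟨le_refl s.1, hst.2⟩) x, rho_trans _ _ _ x⟩⟩
    · have main : ∀ (x : Π₀ i, indSub k (Q i) t) (y : Π₀ i, indSub k (Q i) (t.1, s.2))
          (z : Π₀ i, indSub k (Q i) (s.1, t.2)), dmap k Q _ t y = x → dmap k Q _ t z = x →
          dmap k Q s t (dmap k Q t s x) = x := by
        intro x y z hy hz
        refine DFinsupp.ext fun i => Subtype.ext ?_
        have hy' := dmap_apply Q _ t y i
        have hz' := dmap_apply Q _ t z i
        rw [hy] at hy'
        rw [hz] at hz'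
        rw [dmap_apply, dmap_apply]
        have := key i s t
        by_cases h1 : s ∈ Q i ∧ t ∈ Q i
        · rw [if_pos h1, if_pos h1.symm]
        · rw [if_neg h1]
          by_cases h2 : (t.1, s.2) ∈ Q i
          · have h3 : ¬ (s.1, t.2) ∈ Q i := fun h3 => h1 (this.1 ⟨h2, h3⟩)
            rw [if_neg (fun h => h3 h.1)] at hz'
            exact hz'.symm
          · rw [if_neg (fun h => h2 h.1)] at hy'
            exact hy'.symm
      rintro x ⟨⟨y, hy⟩, ⟨z, hz⟩⟩
      exact ⟨dmap k Q t s x, main x y z hy hz⟩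
  · apply le_antisymm
    · have main : ∀ x : Π₀ i, indSub k (Q i) s, dmap k Q s t x = 0 →
          dmap k Q s (t.1, s.2) (x.filter (fun i => (t.1, s.2) ∉ Q i)) = 0 ∧
          dmap k Q s (s.1, t.2) (x.filter (fun i => ¬ (t.1, s.2) ∉ Q i)) = 0 := by
        intro x hx
        constructor
        · refine DFinsupp.ext fun i => Subtype.ext ?_
          rw [dmap_apply, DFinsupp.filter_apply]
          by_cases h2 : (t.1, s.2) ∈ Q i
          · simp [h2]
          · simp [h2]
        · refine DFinsupp.ext fun i => Subtype.ext ?_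
          have hx' := dmap_apply Q s t x i
          rw [hx] at hx'
          rw [dmap_apply, DFinsupp.filter_apply]
          have := key i s t
          by_cases h2 : (t.1, s.2) ∈ Q i
          · by_cases h3 : (s.1, t.2) ∈ Q i
            · rw [if_pos (this.1 ⟨h2, h3⟩)] at hx'
              rw [if_pos (not_not.2 h2), if_pos ⟨(this.1 ⟨h2, h3⟩).1, h3⟩]
              exact hx'.symm
            · simp [h3]
          · simp [h2]
      intro x hx
      obtain ⟨m1, m2⟩ := main x hx
      exact Submodule.mem_sup.2 ⟨_, m1, _, m2, DFinsupp.filter_add_filter_not _ _⟩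
    · refine sup_le ?_ ?_
      · intro x hx
        rw [LinearMap.mem_ker] at hx ⊢
        rw [← rho_trans _ (show s ≤ (t.1, s.2) from ⟨hst.1, le_refl s.2⟩)
          (show (t.1, s.2) ≤ t from ⟨le_refl t.1, hst.2⟩), hx, map_zero]
      · intro x hx
        rw [LinearMap.mem_ker] at hx ⊢
        rw [← rho_trans _ (show s ≤ (s.1, t.2) from ⟨le_refl s.1, hst.2⟩)
          (show (s.1, t.2) ≤ t from ⟨hst.1, le_refl t.2⟩), hx, map_zero]

theorem weaklyExact_of_decomposable {X Y : Type} [Preorder X] [Preorder Y]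
    (M : PersistenceModule k (X × Y)) (h : RectangleDecomposable k M) : WeaklyExact k M := by
  obtain ⟨ι, R, hR, ⟨e⟩⟩ := h
  let e' : (∐ fun i => indicator k (R i) (hR i).ordConnected) ≅
      dsum R fun i => (hR i).ordConnected :=
    (coproductIsCoproduct _).coconePointUniqueUpToIso
      (dsumIsColimit (k := k) R fun i => (hR i).ordConnected)
  exact weaklyExact_retract (e ≪≫ e').hom (e ≪≫ e').inv (Iso.hom_inv_id _) (dsum_weaklyExact R hR)

theorem iso_option {C : Type*} [Category C] [Preadditive C] {ι : Type} {F : Option ι → C}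
    {M N : C} [HasCoproduct F] [HasCoproduct fun j => F (some j)]
    (f : F none ⟶ M) (g : M ⟶ F none) (i : N ⟶ M) (r : M ⟶ N)
    (hfg : f ≫ g = 𝟙 _) (hig : i ≫ g = 0) (hir : i ≫ r = 𝟙 _) (hfr : f ≫ r = 0)
    (hri : g ≫ f + r ≫ i = 𝟙 M) (e : N ≅ ∐ fun j => F (some j)) : Nonempty (M ≅ ∐ F) := by
  let a : M ⟶ ∐ F := g ≫ Sigma.ι F none + r ≫ e.hom ≫ Sigma.desc fun j => Sigma.ι F (some j)
  let b : (∐ F) ⟶ M := Sigma.desc fun o => match o with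
    | none => f
    | some j => Sigma.ι (fun j => F (some j)) j ≫ e.inv ≫ i
  have hb0 : Sigma.ι F none ≫ b = f := Sigma.ι_desc _ _
  have hbs : ∀ j, Sigma.ι F (some j) ≫ b = Sigma.ι (fun j => F (some j)) j ≫ e.inv ≫ i :=
    fun j => Sigma.ι_desc _ _
  have hbd : (Sigma.desc fun j => Sigma.ι F (some j)) ≫ b = e.inv ≫ i := by
    apply Sigma.hom_ext
    intro j
    rw [Sigma.ι_desc_assoc, hbs]
  refine ⟨⟨a, b, ?_, ?_⟩⟩
  · simp only [a, Preadditive.add_comp, Category.assoc, hb0, hbd, Iso.hom_inv_id_assoc, hri]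
  · apply Sigma.hom_ext
    rintro (_ | j)
    · rw [← Category.assoc, hb0]
      simp only [a, Preadditive.comp_add]
      rw [← Category.assoc, hfg, ← Category.assoc f r, hfr]
      simp
    · rw [← Category.assoc, hbs]
      simp only [a, Preadditive.comp_add, Category.assoc]
      rw [← Category.assoc i g, hig, ← Category.assoc i r, hir]
      simp

/-- The combinatorial heart: choice of a rectangle. -/
theorem exists_rect {X Y : Type} [LinearOrder X] [Finite X] [LinearOrder Y] [Finite Y]
    (M : PersistenceModule k (X × Y)) (hM : WeaklyExact k M)
    (hne : ∃ t, ∃ m : fiber M t, m ≠ 0) :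
    ∃ (s0 t0 : X × Y) (h0 : s0 ≤ t0) (v : fiber M s0) (φ : fiber M t0 →ₗ[k] k),
      (∀ t (h : s0 ≤ t), t ∉ Icc s0 t0 → rho k M h v = 0) ∧
      (∀ t (h : t ≤ t0), t ∉ Icc s0 t0 → ∀ m, φ (rho k M h m) = 0) ∧
      φ (rho k M h0 v) = 1 := by
  -- a minimal
  obtain ⟨a, ⟨c0, m0, hm0⟩, ha⟩ := (Set.toFinite {x : X | ∃ y, ∃ m : fiber M (x, y), m ≠ 0}).exists_minimal
    (by obtain ⟨t, m, hm⟩ := hne; exact ⟨t.1, t.2, m, hm⟩)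
  have ha' : ∀ x, x < a → ∀ y, ∀ m : fiber M (x, y), m = 0 := by
    intro x hx y m
    by_contra hm
    exact absurd (ha ⟨y, m, hm⟩ hx.le) (not_le.2 hx)
  -- b maximal
  obtain ⟨b, ⟨hab, c1, m1, hm1⟩, hb⟩ := (Set.toFinite {x : X | ∃ h : a ≤ x, ∃ y, ∃ m : fiber M (a, y),
      rho k M (show (a, y) ≤ (x, y) from ⟨h, le_rfl⟩) m ≠ 0}).exists_maximal
    ⟨a, le_rfl, c0, m0, by rwa [rho_self]⟩
  have hb' : ∀ x (h : a ≤ x), b < x → ∀ y, ∀ m : fiber M (a, y),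
      rho k M (show (a, y) ≤ (x, y) from ⟨h, le_rfl⟩) m = 0 := by
    intro x h hx y m
    by_contra hm
    exact absurd (hb ⟨h, y, m, hm⟩ hx.le) (not_le.2 hx)
  -- c minimal
  obtain ⟨c, ⟨m2, hm2⟩, hc⟩ := (Set.toFinite {y : Y | ∃ m : fiber M (a, y),
      rho k M (show (a, y) ≤ (b, y) from ⟨hab, le_rfl⟩) m ≠ 0}).exists_minimal
    ⟨c1, m1, hm1⟩
  have hc' : ∀ y, y < c → ∀ m : fiber M (a, y),
      rho k M (show (a, y) ≤ (b, y) from ⟨hab, le_rfl⟩) m = 0 := by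
    intro y hy m
    by_contra hm
    exact absurd (hc ⟨m, hm⟩ hy.le) (not_le.2 hy)
  -- d maximal
  obtain ⟨d, ⟨hcd, w, hw⟩, hd⟩ := (Set.toFinite {y : Y | ∃ h : c ≤ y, ∃ m : fiber M (a, c),
      rho k M (show (a, c) ≤ (b, y) from ⟨hab, h⟩) m ≠ 0}).exists_maximal
    ⟨c, le_rfl, m2, hm2⟩
  have hd' : ∀ y (h : c ≤ y), d < y → ∀ m : fiber M (a, c),
      rho k M (show (a, c) ≤ (b, y) from ⟨hab, h⟩) m = 0 := by
    intro y h hy m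
    by_contra hm
    exact absurd (hd ⟨h, m, hm⟩ hy.le) (not_le.2 hy)
  have h0 : (a, c) ≤ (b, d) := ⟨hab, hcd⟩
  -- the element v
  obtain ⟨v, hv1, hv2⟩ : ∃ v : fiber M (a, c), rho k M h0 v ≠ 0 ∧
      ∀ y (h : c ≤ y), d < y → rho k M (show (a, c) ≤ (a, y) from ⟨le_rfl, h⟩) v = 0 := by
    by_cases hex : ∃ y, d < y
    · obtain ⟨d', hdd', hd''⟩ := (Set.toFinite {y | d < y}).exists_minimal hex
      have hcd' : c ≤ d' := hcd.trans (le_of_lt hdd')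
      have hle : (a, c) ≤ (b, d') := ⟨hab, hcd'⟩
      have hker := (hM (a, c) (b, d') hle).2
      have hwk : w ∈ LinearMap.ker (rho k M hle) := hd' d' hcd' hdd' w
      rw [hker] at hwk
      obtain ⟨u, hu, v, hv, rfl⟩ := Submodule.mem_sup.1 hwk
      rw [LinearMap.mem_ker] at hu hv
      refine ⟨v, ?_, ?_⟩
      · intro hv0
        apply hw
        rw [map_add, hv0, add_zero,
          ← rho_trans M (show (a, c) ≤ (b, c) from ⟨hab, le_rfl⟩)
            (show (b, c) ≤ (b, d) from ⟨le_rfl, hcd⟩)]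
        erw [hu]
        rw [map_zero]
      · intro y hy hdy
        have hd'y : d' ≤ y := by
          by_contra hlt
          exact hlt (hd'' hdy (le_of_lt (not_le.1 hlt)))
        rw [← rho_trans M (show (a, c) ≤ (a, d') from ⟨le_rfl, hcd'⟩)
            (show (a, d') ≤ (a, y) from ⟨le_rfl, hd'y⟩)]
        erw [hv]
        rw [map_zero]
    · exact ⟨w, hw, fun y _ hy => absurd ⟨y, hy⟩ hex⟩
  -- the submodule N
  obtain ⟨N, hN1, hN2⟩ : ∃ N : Submodule k (fiber M (b, d)), rho k M h0 v ∉ N ∧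
      ∀ y (h : y ≤ d), y < c → ∀ m : fiber M (b, y),
        rho k M (show (b, y) ≤ (b, d) from ⟨le_rfl, h⟩) m ∈ N := by
    by_cases hex : ∃ y, y < c
    · obtain ⟨p, hpc, hp⟩ := (Set.toFinite {y | y < c}).exists_maximal hex
      have hpc : p < c := hpc
      have hpd : p ≤ d := hpc.le.trans hcd
      have hle : (a, p) ≤ (b, d) := ⟨hab, hpd⟩
      refine ⟨LinearMap.range (rho k M (show (b, p) ≤ (b, d) from ⟨le_rfl, hpd⟩)), ?_, ?_⟩
      · intro hmem
        have him := (hM (a, p) (b, d) hle).1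
        have : rho k M h0 v ∈ LinearMap.range (rho k M hle) := by
          rw [him]
          exact ⟨hmem, ⟨rho k M (show (a, c) ≤ (a, d) from ⟨le_rfl, hcd⟩) v, rho_trans M _ _ _⟩⟩
        obtain ⟨z, hz⟩ := this
        apply hv1
        rw [← hz, ← rho_trans M (show (a, p) ≤ (b, p) from ⟨hab, le_rfl⟩)
            (show (b, p) ≤ (b, d) from ⟨le_rfl, hpd⟩), hc' p hpc, map_zero]
      · intro y hy hyc m
        have hyp : y ≤ p := by
          by_contra hlt
          exact hlt (hp hyc (le_of_lt (not_le.1 hlt)))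
        exact ⟨rho k M (show (b, y) ≤ (b, p) from ⟨le_rfl, hyp⟩) m, rho_trans M _ _ _⟩
    · exact ⟨⊥, by simpa using hv1, fun y _ hy => absurd ⟨y, hy⟩ hex⟩
  obtain ⟨ψ, hψ1, hψ2⟩ := Submodule.exists_le_ker_of_notMem hN1
  refine ⟨(a, c), (b, d), h0, v, (ψ (rho k M h0 v))⁻¹ • ψ, ?_, ?_, ?_⟩
  · rintro ⟨x, y⟩ h hnot
    have hax : a ≤ x := h.1
    have hcy : c ≤ y := h.2
    by_cases hx : b < x
    · rw [← rho_trans M (show (a, c) ≤ (x, c) from ⟨hax, le_rfl⟩)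
        (show (x, c) ≤ (x, y) from ⟨le_rfl, hcy⟩), hb' x hax hx, map_zero]
    · have hy : d < y := by
        by_contra hy
        exact hnot ⟨h, not_lt.1 hx, not_lt.1 hy⟩
      rw [← rho_trans M (show (a, c) ≤ (a, y) from ⟨le_rfl, hcy⟩)
        (show (a, y) ≤ (x, y) from ⟨hax, le_rfl⟩), hv2 y hcy hy, map_zero]
  · rintro ⟨x, y⟩ h hnot m
    have hxb : x ≤ b := h.1
    have hyd : y ≤ d := h.2
    by_cases hx : x < a
    · rw [ha' x hx y m]; simp
    · have hy : y < c := by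
        by_contra hy
        exact hnot ⟨⟨not_lt.1 hx, not_lt.1 hy⟩, h⟩
      have := hN2 y hyd hy (rho k M (show (x, y) ≤ (b, y) from ⟨hxb, le_rfl⟩) m)
      rw [rho_trans] at this
      have h3 : ψ (rho k M h m) = 0 := hψ2 this
      simp [h3]
  · simp [hψ1]

theorem decomposable_of_weaklyExact {X Y : Type} [LinearOrder X] [Finite X] [LinearOrder Y]
    [Finite Y] (n : ℕ) : ∀ (M : PersistenceModule k (X × Y)), Pfd k M → WeaklyExact k M →
      ∑ᶠ t, Module.finrank k (fiber M t) = n → RectangleDecomposable k M := by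
  induction n using Nat.strong_induction_on with
  | _ n ih =>
  intro M hpfd hM hn
  have := hpfd
  by_cases hne : ∃ t, ∃ m : fiber M t, m ≠ 0
  · obtain ⟨s0, t0, h0, v, φ, hv, hφ, h1⟩ := exists_rect M hM hne
    let f := incl M s0 t0 v hv
    let g := proj M s0 t0 φ hφ
    have hfg : f ≫ g = 𝟙 _ := incl_proj M s0 t0 h0 v hv φ hφ h1
    let i := kernel.ι g
    let r : M ⟶ kernel g := kernel.lift g (𝟙 _ - g ≫ f) (by simp [hfg])
    have hri : g ≫ f + r ≫ i = 𝟙 M := by simp [r, i]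
    have hig : i ≫ g = 0 := kernel.condition g
    have hir : i ≫ r = 𝟙 _ := by
      rw [← cancel_mono i, Category.assoc]
      have : r ≫ i = 𝟙 M - g ≫ f := by simp [r, i]
      rw [this, Preadditive.comp_sub, ← Category.assoc, hig]; simp
    have hfr : f ≫ r = 0 := by
      rw [← cancel_mono i, Category.assoc]
      have : r ≫ i = 𝟙 M - g ≫ f := by simp [r, i]
      rw [this, Preadditive.comp_sub, ← Category.assoc, hfg]; simp
    have hinj : ∀ t, Function.Injective (PMHom.appLin i t) := fun t =>
      Function.LeftInverse.injective (g := (PMHom.appLin r t)) (retract_app i r hir t)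
    have hpfd' : Pfd k (kernel g) := fun t => by
      have := hpfd t
      exact FiniteDimensional.of_injective (PMHom.appLin i t) (hinj t)
    have hlt : ∑ᶠ t, Module.finrank k (fiber (kernel g) t) < n := by
      rw [← hn]
      have := Fintype.ofFinite (X × Y)
      rw [finsum_eq_sum_of_fintype, finsum_eq_sum_of_fintype]
      refine Finset.sum_lt_sum (fun t _ => by
        have := hpfd t
        exact LinearMap.finrank_le_finrank_of_injective (hinj t))
        ⟨s0, Finset.mem_univ _, ?_⟩
      have hr : LinearMap.range (PMHom.appLin i s0) < ⊤ := by
        rw [lt_top_iff_ne_top]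
        intro htop
        have hvm : v ∈ LinearMap.range (PMHom.appLin i s0) := by rw [htop]; trivial
        obtain ⟨z, hz⟩ := hvm
        have h5 : PMHom.appLin g s0 (PMHom.appLin i s0 z) = 0 := by
          have := congrArg (fun q => PMHom.appLin q s0 z) hig
          exact this
        rw [hz] at h5
        exact proj_app_ne M s0 t0 h0 v φ hφ h1 h5
      have := hpfd s0
      have h7 := Submodule.finrank_lt hr.ne
      rwa [LinearMap.finrank_range_of_inj (hinj s0)] at h7
    obtain ⟨ι, R, hR, ⟨e⟩⟩ := ih _ hlt (kernel g) hpfd' (weaklyExact_retract i r hir hM) rfl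
    let R' : Option ι → Set (X × Y) := fun o => o.elim (Icc s0 t0) R
    have hR' : ∀ o, IsRectangle (R' o) := by
      rintro (_ | j)
      · exact ⟨⟨s0, le_rfl, h0⟩, Icc s0.1 t0.1, Icc s0.2 t0.2, ordConnected_Icc,
          ordConnected_Icc, Icc_prod_eq _ _⟩
      · exact hR j
    let F : Option ι → PersistenceModule k (X × Y) :=
      fun o => indicator k (R' o) (hR' o).ordConnected
    exact ⟨Option ι, R', hR', iso_option (F := F) (N := kernel g) f g i r hfg hig hir hfr hri e⟩
  · push Not at hne
    let R : Empty → Set (X × Y) := fun e => e.elim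
    have hR : ∀ o, IsRectangle (R o) := fun e => e.elim
    let F : Empty → PersistenceModule k (X × Y) :=
      fun o => indicator k (R o) (hR o).ordConnected
    let c : Cofan F := Cofan.mk M (fun e => e.elim)
    have hc : IsColimit c := Cofan.IsColimit.mk c (fun s => 0) (fun s e => e.elim) (by
      intro s m _
      apply NatTrans.ext; funext t
      refine ModuleCat.hom_ext (LinearMap.ext fun x => ?_)
      have : x = 0 := hne t x
      rw [this, map_zero, map_zero])
    exact ⟨Empty, R, hR, ⟨hc.coconePointUniqueUpToIso (coproductIsCoproduct F)⟩⟩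

end Main

end PersistencePaper

namespace PersistencePaper

/-- Let `X` and `Y` be finite subsets of `ℝ` and let `M` be a pointwise
finite-dimensional persistence module over the product poset `X × Y`. Then `M` is
rectangle-decomposable if and only if `M` is weakly exact. -/
theorem rectangleDecomposable_iff_weaklyExact (k : Type) [Field k]
    (X Y : Set ℝ) (hX : X.Finite) (hY : Y.Finite)
    (M : PersistenceModule k (↥X × ↥Y)) (hM : Pfd k M) :
    RectangleDecomposable k M ↔ WeaklyExact k M := by
  have := hX.to_subtype
  have := hY.to_subtype
  exact ⟨weaklyExact_of_decomposable M, fun h => decomposable_of_weaklyExact _ M hM h rfl⟩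

end PersistencePaper
end
end

section
/- Let n, m ≥ 1 and let k ∈ {1, …, n}, l ∈ {1, …, m}. Then the indicator module k_{[1,k] × [1,l]} is an injective object in the category of persistence modules over the finite grid [1,n] × [1,m]: every monomorphism from k_{[1,k] × [1,l]} into a persistence module over [1,n] × [1,m] splits. -/
open CategoryTheory Limits Set

noncomputable section

set_option linter.unusedSectionVars false

attribute [local instance] Classical.propDecidable

namespace PersistencePaper

theorem indicator_Iic_splits (k : Type) [Field k] {P : Type} [Preorder P] (p : P)
    (N : PersistenceModule k P)
    (f : PMHom (indicator k (Set.Iic p) Set.ordConnected_Iic) N)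
    (hf : ∀ t : P, Function.Injective (f.appLin t)) :
    ∃ g : PMHom N (indicator k (Set.Iic p) Set.ordConnected_Iic),
      ∀ t : P, (g.appLin t).comp (f.appLin t) = LinearMap.id := by
  obtain ⟨r, hr⟩ := LinearMap.exists_leftInverse_of_injective (f.appLin p)
    (LinearMap.ker_eq_bot.mpr (hf p))
  have hr' : ∀ x : indSub k (Set.Iic p) p,
      r (f.appLin p x) = x := fun x => LinearMap.congr_fun hr x
  let r' : N.obj p →ₗ[k] k := (indSub k (Set.Iic p) p).subtype ∘ₗ r
  let gl : ∀ t, N.obj t →ₗ[k] indSub k (Set.Iic p) t := fun t =>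
    LinearMap.codRestrict _
      (if h : t ≤ p then r' ∘ₗ (N.map (homOfLE h)).hom else 0) (by
        intro x ht
        have ht' : ¬ t ≤ p := ht
        rw [dif_neg ht']; rfl)
  have hgl : ∀ t (h : t ≤ p) (x : N.obj t),
      ((gl t x : indSub k (Set.Iic p) t) : k) = r' ((N.map (homOfLE h)).hom x) := by
    intro t h x
    simp only [gl, LinearMap.codRestrict_apply, dif_pos h]
    rfl
  refine ⟨{ app := fun t => ModuleCat.ofHom (gl t), naturality := ?_ }, ?_⟩
  · intro s t u
    refine ModuleCat.hom_ext (LinearMap.ext fun x => Subtype.ext ?_)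
    show ((gl t ((N.map u).hom x) : indSub k (Set.Iic p) t) : k)
      = (indMap k (Set.Iic p) s t (gl s x) : k)
    rw [indMap_coe]
    by_cases ht : t ≤ p
    · have hs : s ≤ p := (leOfHom u).trans ht
      rw [if_pos ⟨hs, ht⟩, hgl t ht, hgl s hs]
      have : N.map (homOfLE hs) = N.map u ≫ N.map (homOfLE ht) := by
        rw [← N.map_comp]; rfl
      rw [this]; rfl
    · rw [if_neg (fun h => ht h.2)]
      exact (gl t _).2 ht
  · intro t
    refine LinearMap.ext fun x => Subtype.ext ?_
    show ((gl t (f.appLin t x) : indSub k (Set.Iic p) t) : k) = x.1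
    by_cases ht : t ≤ p
    · rw [hgl t ht]
      have hn : (N.map (homOfLE ht)).hom (f.appLin t x)
          = f.appLin p (indMap k (Set.Iic p) t p x) :=
        (LinearMap.congr_fun (congrArg ModuleCat.Hom.hom (f.naturality (homOfLE ht))) x).symm
      rw [hn]
      exact (congrArg Subtype.val (hr' (indMap k (Set.Iic p) t p x))).trans
        (if_pos ⟨ht, le_refl p⟩)
    · exact ((gl t _).2 ht).trans (x.2 ht).symm

/-- Over the grid `[1,n] × [1,m]`, the indicator module of a
lower-left rectangle `[1,k] × [1,l]` is an injective persistence module: every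
monomorphism out of it splits (i.e. admits a retraction). -/
theorem indicator_lower_left_rectangle_injective (k : Type) [Field k]
    (n m : ℕ) (k0 : Fin n) (l0 : Fin m)
    (N : PersistenceModule k (Fin n × Fin m))
    (f : PMHom (indicator k (Set.Iic (k0, l0)) Set.ordConnected_Iic) N)
    (hf : ∀ t : Fin n × Fin m, Function.Injective (f.appLin t)) :
    ∃ g : PMHom N (indicator k (Set.Iic (k0, l0)) Set.ordConnected_Iic),
      ∀ t : Fin n × Fin m, (g.appLin t).comp (f.appLin t) = LinearMap.id := by
  exact indicator_Iic_splits k (k0, l0) N f hf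

end PersistencePaper
end
end

section
/- A pointwise finite-dimensional persistence module M over a finite grid X × Y is weakly exact if and only if, for every pair of indices s = (s_x, s_y) ≤ t = (t_x, t_y) in X × Y, the restriction of M to the four-element subposet {s, (t_x, s_y), (s_x, t_y), t} is rectangle-decomposable, i.e. isomorphic to a direct sum of indicator modules of rectangles of this 2 × 2 square. -/
open CategoryTheory Limits Set

noncomputable section

set_option linter.unusedSectionVars false

attribute [local instance] Classical.propDecidable

namespace PersistencePaper

section Helpers

variable {k : Type} [Field k] {P : Type} [Preorder P]

def Good (N : PersistenceModule k P) {ι : Type} (Q : ι → Set P) (e : ι → ∀ t, N.obj t) : Prop :=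
  (∀ i t, t ∉ Q i → e i t = 0) ∧
  (∀ i s t (h : s ≤ t), s ∈ Q i → rho k N h (e i s) = e i t) ∧
  (∀ t (x : ι →₀ k), Finsupp.linearCombination k (fun i => e i t) x = 0 →
    ∀ i, t ∈ Q i → x i = 0) ∧
  (∀ t, Submodule.span k (Set.range fun i => e i t) = ⊤)

def unitVec (Q : Set P) (t : P) : indSub k Q t :=
  ⟨if t ∈ Q then 1 else 0, fun h => by simp [h]⟩

theorem smul_unitVec (Q : Set P) (t : P) (x : indSub k Q t) :
    (x : k) • (unitVec Q t : indSub k Q t) = x := by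
  apply Subtype.ext
  by_cases h : t ∈ Q
  · simp [unitVec, h]
  · have := x.2 h
    simp [unitVec, h, this]

theorem indMap_unitVec (Q : Set P) (s t : P) (hs : s ∈ Q) :
    indMap k Q s t (unitVec Q s) = unitVec Q t := by
  apply Subtype.ext
  rw [indMap_coe]
  by_cases h : t ∈ Q <;> simp [unitVec, h, hs]

theorem good_of_iso (N : PersistenceModule k P) {ι : Type} (Q : ι → Set P)
    (hQ : ∀ i, (Q i).OrdConnected) (φ : N ≅ ∐ fun i => indicator k (Q i) (hQ i)) :
    ∃ e, Good N Q e := by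
  let F := fun i => indicator k (Q i) (hQ i)
  let inj : ∀ i, F i ⟶ N := fun i => Sigma.ι F i ≫ φ.inv
  let proj : ∀ i, N ⟶ F i := fun j => φ.hom ≫
    Sigma.desc (fun i => if h : i = j then eqToHom (congrArg F h) else 0)
  have hself : ∀ i, inj i ≫ proj i = 𝟙 _ := by
    intro i; simp only [inj, proj, Category.assoc, Iso.inv_hom_id_assoc]; exact (Limits.Sigma.ι_desc _ _).trans (by simp; rfl)
  have hne : ∀ i j, i ≠ j → inj i ≫ proj j = 0 := by
    intro i j hij; simp only [inj, proj, Category.assoc, Iso.inv_hom_id_assoc]; exact (Limits.Sigma.ι_desc _ _).trans (by simp [hij])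
  have hepi : ∀ t (Z : ModuleCat k) (f g : N.obj t ⟶ Z),
      (∀ i, (inj i).app t ≫ f = (inj i).app t ≫ g) → f = g := by
    intro t Z f g h
    rw [← cancel_epi (φ.inv.app t)]
    refine (isColimitOfPreserves ((evaluation P (ModuleCat k)).obj t)
      (colimit.isColimit (Discrete.functor F))).hom_ext ?_
    rintro ⟨i⟩
    have := h i
    simpa [inj] using this
  refine ⟨fun i t => ((inj i).app t).hom (unitVec (Q i) t), ?_, ?_, ?_, ?_⟩
  · intro i t ht
    have : (unitVec (Q i) t : indSub k (Q i) t) = 0 := by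
      apply Subtype.ext; simp [unitVec, ht]
    simp only [this]
    exact map_zero _
  · intro i s t h hs
    have := congrArg (fun f => f.hom (unitVec (Q i) s)) ((inj i).naturality (homOfLE h))
    have h2 := indMap_unitVec (k := k) (Q i) s t hs
    refine this.symm.trans ?_
    exact congrArg ((inj i).app t).hom h2
  · intro t x hx i hi
    have h1 := congrArg ((proj i).app t).hom hx
    rw [map_zero, Finsupp.linearCombination_apply, Finsupp.sum, map_sum] at h1
    rw [Finset.sum_eq_single i] at h1
    · rw [map_smul] at h1
      have h2 := congrArg (fun f => (f.app t).hom (unitVec (Q i) t)) (hself i)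
      have h3 : ((proj i).app t).hom (((inj i).app t).hom (unitVec (Q i) t)) = unitVec (Q i) t := h2
      rw [h3] at h1
      have h4 : x i * (if t ∈ Q i then 1 else 0) = 0 := congrArg Subtype.val h1
      simpa [hi] using h4
    · intro j _ hj
      rw [map_smul]
      have h2 := congrArg (fun f => (f.app t).hom (unitVec (Q j) t)) (hne j i hj)
      have h3 : ((proj i).app t).hom (((inj j).app t).hom (unitVec (Q j) t)) = 0 := h2
      rw [h3, smul_zero]
    · intro h
      rw [Finsupp.notMem_support_iff] at h
      rw [h, zero_smul, map_zero]
  · intro t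
    set W := Submodule.span k (Set.range fun i => ((inj i).app t).hom (unitVec (Q i) t)) with hW
    have := hepi t (ModuleCat.of k (N.obj t ⧸ W)) (ModuleCat.ofHom W.mkQ) 0 (by
      intro i
      refine ModuleCat.hom_ext (LinearMap.ext fun x => ?_)
      let G : indSub k (Q i) t →ₗ[k] N.obj t := ((inj i).app t).hom
      have key : ∀ x : indSub k (Q i) t, W.mkQ (G x) = 0 := by
        intro x
        rw [Submodule.mkQ_apply, Submodule.Quotient.mk_eq_zero,
          ← smul_unitVec (k := k) (Q i) t x, map_smul]
        exact W.smul_mem _ (Submodule.subset_span ⟨i, rfl⟩)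
      exact key x)
    rw [eq_top_iff]
    intro m _
    have h2 := congrArg (fun f => f.hom m) this
    have h3 : W.mkQ m = 0 := h2
    rwa [Submodule.mkQ_apply, Submodule.Quotient.mk_eq_zero] at h3

theorem iso_of_good (N : PersistenceModule k P) {ι : Type} (Q : ι → Set P)
    (hQ : ∀ i, (Q i).OrdConnected) (e : ι → ∀ t, N.obj t) (h : Good N Q e) :
    Nonempty (N ≅ ∐ fun i => indicator k (Q i) (hQ i)) := by
  obtain ⟨h1, h2, h3, h4⟩ := h
  let F := fun i => indicator k (Q i) (hQ i)
  let inj : ∀ i, F i ⟶ N := fun i =>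
    { app := fun t => ModuleCat.ofHom ((LinearMap.toSpanSingleton k (N.obj t) (e i t)).comp
        (indSub k (Q i) t).subtype)
      naturality := by
        intro s t f
        refine ModuleCat.hom_ext (LinearMap.ext fun x => ?_)
        have key : ∀ x : indSub k (Q i) s,
            (indMap k (Q i) s t x : k) • e i t = rho k N (leOfHom f) (x.1 • e i s) := by
          intro x
          rw [indMap_coe, map_smul]
          by_cases hs : s ∈ Q i
          · rw [h2 i s t _ hs]
            by_cases ht : t ∈ Q i
            · simp [hs, ht]
            · simp [h1 i t ht]
          · simp [hs, h1 i s hs]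
        exact key x }
  let b : ∀ t, Module.Basis {i // t ∈ Q i} k (N.obj t) := fun t =>
    Module.Basis.mk (v := fun i => e i.1 t) (by
      rw [linearIndependent_iff]
      intro l hl
      have := h3 t (Finsupp.mapDomain Subtype.val l) (by
        rw [Finsupp.linearCombination_mapDomain]; exact hl)
      ext i
      have := this i.1 i.2
      rwa [Finsupp.mapDomain_apply Subtype.val_injective] at this) (by
      rw [← h4 t, Submodule.span_le]
      rintro _ ⟨i, rfl⟩
      by_cases ht : t ∈ Q i
      · exact Submodule.subset_span ⟨⟨i, ht⟩, rfl⟩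
      · simp only [h1 i t ht]; exact Submodule.zero_mem _)
  have hb : ∀ t i, b t i = e i.1 t := fun t i => by simp [b]
  have hnat : ∀ (Z : PersistenceModule k P) (g : ∀ i, F i ⟶ Z) i s t (hst : s ≤ t) (hs : s ∈ Q i),
      rho k Z hst (((g i).app s).hom (unitVec (Q i) s)) = ((g i).app t).hom (unitVec (Q i) t) := by
    intro Z g i s t hst hs
    have := congrArg (fun f => f.hom (unitVec (Q i) s)) ((g i).naturality (homOfLE hst))
    refine this.symm.trans ?_
    exact congrArg ((g i).app t).hom (indMap_unitVec (k := k) (Q i) s t hs)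
  have hz : ∀ (Z : PersistenceModule k P) (g : ∀ i, F i ⟶ Z) i t (ht : t ∉ Q i),
      ((g i).app t).hom (unitVec (Q i) t) = 0 := by
    intro Z g i t ht
    have : (unitVec (Q i) t : indSub k (Q i) t) = 0 := by
      apply Subtype.ext; simp [unitVec, ht]
    rw [this]
    exact map_zero _
  let d : ∀ (Z : PersistenceModule k P) (g : ∀ i, F i ⟶ Z) t, N.obj t →ₗ[k] Z.obj t :=
    fun Z g t => (b t).constr k (fun i => ((g i.1).app t).hom (unitVec (Q i.1) t))
  have hd : ∀ Z g t i, d Z g t (e i t) = ((g i).app t).hom (unitVec (Q i) t) := by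
    intro Z g t i
    by_cases ht : t ∈ Q i
    · rw [← hb t ⟨i, ht⟩]
      exact (b t).constr_basis k _ _
    · rw [h1 i t ht, hz Z g i t ht, map_zero]
  let desc : ∀ (Z : PersistenceModule k P) (g : ∀ i, F i ⟶ Z), N ⟶ Z := fun Z g =>
    { app := fun t => ModuleCat.ofHom (d Z g t)
      naturality := by
        intro s t f
        refine ModuleCat.hom_ext ((b s).ext fun i => ?_)
        show d Z g t (rho k N (leOfHom f) (b s i)) = rho k Z (leOfHom f) (d Z g s (b s i))
        rw [hb, h2 _ _ _ _ i.2, hd, hd, hnat _ _ _ _ _ _ i.2] }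
  have hinj : ∀ i t, ((inj i).app t).hom (unitVec (Q i) t) = e i t := by
    intro i t
    show (if t ∈ Q i then (1 : k) else 0) • e i t = e i t
    by_cases ht : t ∈ Q i
    · simp [ht]
    · simp [h1 i t ht]
  let c : Cofan F := Cofan.mk N inj
  have hc : IsColimit c := Cofan.IsColimit.mk c (fun Z => desc Z.pt Z.inj)
    (by
      intro Z i
      refine NatTrans.ext (funext fun t => ModuleCat.hom_ext (LinearMap.ext fun x => ?_))
      let G : indSub k (Q i) t →ₗ[k] N.obj t := ((inj i).app t).hom
      let G' : indSub k (Q i) t →ₗ[k] Z.pt.obj t := ((Z.inj i).app t).hom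
      have hG : G (unitVec (Q i) t) = e i t := hinj i t
      have hG' : d Z.pt Z.inj t (e i t) = G' (unitVec (Q i) t) := hd Z.pt Z.inj t i
      have key : ∀ x : indSub k (Q i) t, d Z.pt Z.inj t (G x) = G' x := by
        intro x
        rw [← smul_unitVec (k := k) (Q i) t x, map_smul, map_smul, hG, map_smul, hG']
      exact key x)
    (by
      intro Z m hm
      refine NatTrans.ext (funext fun t => ModuleCat.hom_ext ((b t).ext fun i => ?_))
      show (m.app t).hom (b t i) = d Z.pt Z.inj t (b t i)
      rw [hb, hd, ← hinj, ← hm i.1]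
      rfl)
  exact ⟨hc.coconePointUniqueUpToIso (colimit.isColimit (Discrete.functor F))⟩

end Helpers
end PersistencePaper
namespace PersistencePaper

section Helpers2

variable {k : Type} [Field k] {P : Type} [Preorder P]

theorem Good.exists_lc {N : PersistenceModule k P} {ι : Type} {Q : ι → Set P}
    {e : ι → ∀ t, N.obj t} (h : Good N Q e) (t : P) (m : N.obj t) :
    ∃ x : ι →₀ k, (∀ i, t ∉ Q i → x i = 0) ∧
      Finsupp.linearCombination k (fun i => e i t) x = m := by
  obtain ⟨h1, -, -, h4⟩ := h
  have hm : m ∈ Submodule.span k (Set.range fun i => e i t) := by rw [h4]; trivial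
  rw [Finsupp.mem_span_range_iff_exists_finsupp] at hm
  obtain ⟨x, hx⟩ := hm
  refine ⟨x.filter (fun i => t ∈ Q i), fun i hi => Finsupp.filter_apply_neg _ _ hi, ?_⟩
  rw [← hx, Finsupp.linearCombination_apply]
  have h5 : ((x.filter (fun i => t ∈ Q i)).sum fun i a => a • e i t)
      + ((x.filter (fun i => ¬ t ∈ Q i)).sum fun i a => a • e i t) = x.sum fun i a => a • e i t := by
    rw [← Finsupp.sum_add_index' (by simp) (by simp [add_smul]), Finsupp.filter_add_filter_not]
  rw [← h5]
  have h6 : ((x.filter (fun i => ¬ t ∈ Q i)).sum fun i a => a • e i t) = 0 := by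
    refine Finset.sum_eq_zero fun i hi => ?_
    have : t ∉ Q i := by
      rw [Finsupp.support_filter, Finset.mem_filter] at hi
      exact hi.2
    simp [h1 i t this]
  rw [h6, add_zero]

theorem Good.rho_lc {N : PersistenceModule k P} {ι : Type} {Q : ι → Set P}
    {e : ι → ∀ t, N.obj t} (h : Good N Q e) {s t : P} (hst : s ≤ t) (x : ι →₀ k)
    (hx : ∀ i, s ∉ Q i → x i = 0) :
    rho k N hst (Finsupp.linearCombination k (fun i => e i s) x) =
      Finsupp.linearCombination k (fun i => e i t) x := by
  rw [Finsupp.linearCombination_apply, Finsupp.linearCombination_apply, Finsupp.sum, Finsupp.sum,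
    map_sum]
  refine Finset.sum_congr rfl fun i _ => ?_
  rw [map_smul]
  by_cases hs : s ∈ Q i
  · rw [h.2.1 i s t hst hs]
  · rw [hx i hs, zero_smul, zero_smul]

theorem Good.lc_eq_zero {N : PersistenceModule k P} {ι : Type} {Q : ι → Set P}
    {e : ι → ∀ t, N.obj t} (h : Good N Q e) (t : P) (x : ι →₀ k)
    (hx : ∀ i, t ∈ Q i → x i = 0) :
    Finsupp.linearCombination k (fun i => e i t) x = 0 := by
  rw [Finsupp.linearCombination_apply]
  refine Finset.sum_eq_zero fun i _ => ?_
  by_cases hs : t ∈ Q i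
  · simp [hx i hs]
  · simp [h.1 i t hs]

theorem Good.congr {N : PersistenceModule k P} {ι : Type} {Q : ι → Set P}
    {e : ι → ∀ t, N.obj t} (h : Good N Q e) (t : P) (x y : ι →₀ k)
    (hx : ∀ i, t ∈ Q i → x i = y i) :
    Finsupp.linearCombination k (fun i => e i t) x =
      Finsupp.linearCombination k (fun i => e i t) y := by
  rw [← sub_eq_zero, ← map_sub]
  exact h.lc_eq_zero t _ fun i hi => by simp [hx i hi]

theorem Good.exact {N : PersistenceModule k P} {ι : Type} {Q : ι → Set P}
    {e : ι → ∀ t, N.obj t} (h : Good N Q e) {a b c d : P} (hab : a ≤ b) (hac : a ≤ c)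
    (hbd : b ≤ d) (hcd : c ≤ d) (had : a ≤ d)
    (hI : ∀ i, b ∈ Q i → c ∈ Q i → d ∈ Q i → a ∈ Q i)
    (hK : ∀ i, a ∈ Q i → b ∈ Q i → c ∈ Q i → d ∈ Q i) :
    LinearMap.range (rho k N had) = LinearMap.range (rho k N hbd) ⊓ LinearMap.range (rho k N hcd) ∧
    LinearMap.ker (rho k N had) = LinearMap.ker (rho k N hab) ⊔ LinearMap.ker (rho k N hac) := by
  have c1 : ∀ x, rho k N had x = rho k N hbd (rho k N hab x) := by
    intro x
    have : N.map (homOfLE had) = N.map (homOfLE hab) ≫ N.map (homOfLE hbd) := by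
      rw [← N.map_comp]; rfl
    exact congrArg (fun f => f.hom x) this
  have c2 : ∀ x, rho k N had x = rho k N hcd (rho k N hac x) := by
    intro x
    have : N.map (homOfLE had) = N.map (homOfLE hac) ≫ N.map (homOfLE hcd) := by
      rw [← N.map_comp]; rfl
    exact congrArg (fun f => f.hom x) this
  constructor
  · apply le_antisymm
    · rintro _ ⟨x, rfl⟩
      exact ⟨⟨_, (c1 x).symm⟩, ⟨_, (c2 x).symm⟩⟩
    · rintro y ⟨⟨β, hβ⟩, ⟨γ, hγ⟩⟩
      obtain ⟨x, hx, rfl⟩ := h.exists_lc b β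
      obtain ⟨z, hz, rfl⟩ := h.exists_lc c γ
      rw [h.rho_lc hbd x hx] at hβ
      rw [h.rho_lc hcd z hz] at hγ
      have hxz := h.2.2.1 d (x - z) (by rw [map_sub, hβ, hγ, sub_self])
      refine ⟨Finsupp.linearCombination k (fun i => e i a) (x.filter (fun i => a ∈ Q i)), ?_⟩
      rw [h.rho_lc had _ (fun i hi => Finsupp.filter_apply_neg _ _ hi), ← hβ]
      apply h.congr
      intro i hi
      by_cases ha : a ∈ Q i
      · exact Finsupp.filter_apply_pos _ _ ha
      · rw [Finsupp.filter_apply, if_neg ha]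
        by_contra hne
        apply ha
        have h5 := hxz i hi
        rw [Finsupp.sub_apply, sub_eq_zero] at h5
        refine hI i ?_ ?_ hi
        · by_contra hb; exact hne (hx i hb).symm
        · by_contra hc; exact hne (by rw [h5, hz i hc])
  · apply le_antisymm
    · intro α hα
      rw [LinearMap.mem_ker] at hα
      obtain ⟨x, hx, rfl⟩ := h.exists_lc a α
      rw [h.rho_lc had x hx] at hα
      have h0 := h.2.2.1 d x hα
      rw [← Finsupp.filter_add_filter_not x (fun i => b ∈ Q i), map_add, add_comm]
      refine Submodule.add_mem_sup ?_ ?_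
      · rw [LinearMap.mem_ker, h.rho_lc hab]
        · apply h.lc_eq_zero
          intro i hi
          exact Finsupp.filter_apply_neg _ _ (by simpa using hi)
        · intro i hi
          by_cases hb : b ∈ Q i
          · exact Finsupp.filter_apply_neg _ _ (by simpa using hb)
          · rw [Finsupp.filter_apply, if_pos hb, hx i hi]
      · rw [LinearMap.mem_ker, h.rho_lc hac]
        · apply h.lc_eq_zero
          intro i hi
          by_cases hb : b ∈ Q i
          · rw [Finsupp.filter_apply, if_pos hb]
            by_cases ha : a ∈ Q i
            · exact h0 i (hK i ha hb hi)
            · exact hx i ha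
          · exact Finsupp.filter_apply_neg _ _ hb
        · intro i hi
          by_cases hb : b ∈ Q i
          · rw [Finsupp.filter_apply, if_pos hb, hx i hi]
          · exact Finsupp.filter_apply_neg _ _ hb
    · rw [sup_le_iff]
      constructor <;> intro x hx <;> rw [LinearMap.mem_ker] at hx ⊢
      · rw [c1, hx, map_zero]
      · rw [c2, hx, map_zero]

/-- Passing from subspaces to bases. -/
theorem exists_bases {J : Type} [Fintype J] {T : Type} [AddCommGroup T] [Module k T]
    (V : J → Submodule k T) :
    ∃ (ι : Type) (lab : ι → J) (e : ι → T), (∀ i, e i ∈ V (lab i)) ∧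
      ∀ (W : Type) [AddCommGroup W] [Module k W] (π : T →ₗ[k] W) (q : J → Prop),
        (∀ v : J → T, (∀ j, v j ∈ V j) → ∑ j, π (v j) = 0 → ∀ j, q j → v j = 0) →
        (∀ w, ∃ v : J → T, (∀ j, v j ∈ V j) ∧ ∑ j, π (v j) = w) →
        (∀ x : ι →₀ k, Finsupp.linearCombination k (fun i => π (e i)) x = 0 →
          ∀ i, q (lab i) → x i = 0) ∧
        Submodule.span k (Set.range fun i => π (e i)) = ⊤ := by
  let b := fun j => Module.Basis.ofVectorSpace k (V j)
  refine ⟨Σ j, Module.Basis.ofVectorSpaceIndex k (V j), fun i => i.1, fun i => (b i.1 i.2 : V i.1),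
    fun i => (b i.1 i.2).2, ?_⟩
  intro W _ _ π q hinj hspan
  constructor
  · intro x hx i hi
    let v : ∀ j, V j := fun j => Finsupp.linearCombination k (b j) (x.split j)
    have hv : ∑ j, π (v j : T) = 0 := by
      rw [← hx, Finsupp.linearCombination_apply, Finsupp.sigma_sum]
      rw [Finset.sum_subset (Finset.subset_univ x.splitSupport)]
      · refine Finset.sum_congr rfl fun j _ => ?_
        simp only [v, Finsupp.linearCombination_apply, Finsupp.sum]
        simp
      · intro j _ hj
        rw [Finsupp.mem_splitSupport_iff_nonzero, not_not] at hj
        rw [hj, Finsupp.sum_zero_index]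
    have h0 := hinj (fun j => v j) (fun j => (v j).2) hv i.1 hi
    have h1 : Finsupp.linearCombination k (b i.1) (x.split i.1) = 0 := Subtype.ext h0
    have h2 := linearIndependent_iff.1 (b i.1).linearIndependent _ h1
    have h3 := DFunLike.congr_fun h2 i.2
    simpa [Finsupp.split_apply] using h3
  · rw [eq_top_iff]
    intro w _
    obtain ⟨v, hv, rfl⟩ := hspan w
    refine Submodule.sum_mem _ fun j _ => ?_
    have h1 : (⟨v j, hv j⟩ : V j) ∈ Submodule.span k (Set.range (b j)) := by
      rw [(b j).span_eq]; trivial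
    have h2 := Submodule.mem_map_of_mem (f := π.comp (V j).subtype) h1
    rw [Submodule.map_span] at h2
    refine Submodule.span_mono ?_ h2
    rintro _ ⟨_, ⟨i, rfl⟩, rfl⟩
    exact ⟨⟨j, i⟩, rfl⟩

theorem exists_rel_compl {A : Type} [AddCommGroup A] [Module k A] (K F : Submodule k A)
    (h : K ≤ F) : ∃ K', K' ≤ F ∧ (∀ x, x ∈ K → x ∈ K' → x = 0) ∧
      ∀ x ∈ F, ∃ y ∈ K, ∃ z ∈ K', y + z = x := by
  obtain ⟨C, hC⟩ := Submodule.exists_isCompl K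
  refine ⟨C ⊓ F, inf_le_right, ?_, ?_⟩
  · intro x hx hx'
    exact Submodule.disjoint_def.1 hC.disjoint x hx hx'.1
  · intro x hx
    have : x ∈ K ⊔ C := by rw [hC.sup_eq_top]; trivial
    obtain ⟨y, hy, z, hz, rfl⟩ := Submodule.mem_sup.1 this
    refine ⟨y, hy, z, ⟨hz, ?_⟩, rfl⟩
    simpa using F.sub_mem hx (h hy)

end Helpers2
end PersistencePaper
namespace PersistencePaper

section Helpers3

def qa : Fin 9 → Prop := fun j => j = 0 ∨ j = 1 ∨ j = 2 ∨ j = 3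
def qb : Fin 9 → Prop := fun j => j = 2 ∨ j = 3 ∨ j = 4 ∨ j = 5
def qc : Fin 9 → Prop := fun j => j = 1 ∨ j = 3 ∨ j = 6 ∨ j = 7
def qd : Fin 9 → Prop := fun j => j = 3 ∨ j = 5 ∨ j = 7 ∨ j = 8

theorem fin_nine_cases (p : Fin 9 → Prop) (h0 : p 0) (h1 : p 1) (h2 : p 2) (h3 : p 3) (h4 : p 4)
    (h5 : p 5) (h6 : p 6) (h7 : p 7) (h8 : p 8) : ∀ j, p j := by
  intro j
  fin_cases j <;> assumption

theorem fin_nine_sum {W : Type} [AddCommGroup W] (u : Fin 9 → W) :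
    ∑ j, u j = u 0 + u 1 + u 2 + u 3 + u 4 + u 5 + u 6 + u 7 + u 8 := by
  rw [Fin.sum_univ_castSucc, Fin.sum_univ_eight]
  rfl

variable {k : Type} [Field k]

def quad {Z A B C D : Type} [AddCommGroup Z] [Module k Z] [AddCommGroup A] [Module k A]
    [AddCommGroup B] [Module k B]
    [AddCommGroup C] [Module k C] [AddCommGroup D] [Module k D]
    (f : Z →ₗ[k] A) (g : Z →ₗ[k] B) (h : Z →ₗ[k] C) (l : Z →ₗ[k] D) :
    Z →ₗ[k] A × B × C × D := f.prod (g.prod (h.prod l))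

theorem square_bases {A B C D : Type} [AddCommGroup A] [Module k A] [AddCommGroup B] [Module k B]
    [AddCommGroup C] [Module k C] [AddCommGroup D] [Module k D]
    (f : A →ₗ[k] B) (g : A →ₗ[k] C) (h : B →ₗ[k] D) (l : C →ₗ[k] D)
    (comm : ∀ x, h (f x) = l (g x)) (hI : ∀ y z, h y = l z → ∃ x, h (f x) = h y)
    (hK : ∀ x, h (f x) = 0 → ∃ y z, f y = 0 ∧ g z = 0 ∧ y + z = x) :
    ∃ (ι : Type) (lab : ι → Fin 9) (ea : ι → A) (eb : ι → B) (ec : ι → C) (ed : ι → D),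
      (∀ i, ¬ qa (lab i) → ea i = 0) ∧ (∀ i, ¬ qb (lab i) → eb i = 0) ∧
      (∀ i, ¬ qc (lab i) → ec i = 0) ∧ (∀ i, ¬ qd (lab i) → ed i = 0) ∧
      (∀ i, qa (lab i) → f (ea i) = eb i) ∧ (∀ i, qa (lab i) → g (ea i) = ec i) ∧
      (∀ i, qb (lab i) → h (eb i) = ed i) ∧ (∀ i, qc (lab i) → l (ec i) = ed i) ∧
      ((∀ x : ι →₀ k, Finsupp.linearCombination k ea x = 0 → ∀ i, qa (lab i) → x i = 0) ∧
        Submodule.span k (Set.range ea) = ⊤) ∧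
      ((∀ x : ι →₀ k, Finsupp.linearCombination k eb x = 0 → ∀ i, qb (lab i) → x i = 0) ∧
        Submodule.span k (Set.range eb) = ⊤) ∧
      ((∀ x : ι →₀ k, Finsupp.linearCombination k ec x = 0 → ∀ i, qc (lab i) → x i = 0) ∧
        Submodule.span k (Set.range ec) = ⊤) ∧
      ((∀ x : ι →₀ k, Finsupp.linearCombination k ed x = 0 → ∀ i, qd (lab i) → x i = 0) ∧
        Submodule.span k (Set.range ed) = ⊤) := by
  obtain ⟨K1, K1le, K1d, K1s⟩ := exists_rel_compl (LinearMap.ker f ⊓ LinearMap.ker g)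
    (LinearMap.ker f) inf_le_left
  obtain ⟨K2, K2le, K2d, K2s⟩ := exists_rel_compl (LinearMap.ker f ⊓ LinearMap.ker g)
    (LinearMap.ker g) inf_le_right
  obtain ⟨A0, -, A0d, A0s⟩ := exists_rel_compl (LinearMap.ker (h.comp f)) ⊤ le_top
  obtain ⟨B1, B1le, B1d, B1s⟩ := exists_rel_compl (Submodule.map f K2) (LinearMap.ker h) (by
    rintro _ ⟨x, hx, rfl⟩
    have : g x = 0 := K2le hx
    rw [LinearMap.mem_ker, comm, this, map_zero])
  obtain ⟨C1, C1le, C1d, C1s⟩ := exists_rel_compl (Submodule.map g K1) (LinearMap.ker l) (by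
    rintro _ ⟨x, hx, rfl⟩
    have : f x = 0 := K1le hx
    rw [LinearMap.mem_ker, ← comm, this, map_zero])
  obtain ⟨B2, -, B2d, B2s⟩ := exists_rel_compl (LinearMap.range f ⊔ LinearMap.ker h) ⊤ le_top
  obtain ⟨C2, -, C2d, C2s⟩ := exists_rel_compl (LinearMap.range g ⊔ LinearMap.ker l) ⊤ le_top
  obtain ⟨D1, -, D1d, D1s⟩ := exists_rel_compl (LinearMap.range h ⊔ LinearMap.range l) ⊤ le_top
  -- element forms
  have k1f : ∀ x ∈ K1, f x = 0 := fun x hx => K1le hx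
  have k2g : ∀ x ∈ K2, g x = 0 := fun x hx => K2le hx
  have b1h : ∀ x ∈ B1, h x = 0 := fun x hx => B1le hx
  have c1l : ∀ x ∈ C1, l x = 0 := fun x hx => C1le hx
  have k1z : ∀ x ∈ K1, g x = 0 → x = 0 := fun x hx hg => K1d x ⟨k1f x hx, hg⟩ hx
  have k2z : ∀ x ∈ K2, f x = 0 → x = 0 := fun x hx hf => K2d x ⟨hf, k2g x hx⟩ hx
  have a0z : ∀ x ∈ A0, h (f x) = 0 → x = 0 := fun x hx hp => A0d x hp hx
  have b2z : ∀ y ∈ B2, ∀ x, h (f x) = h y → y = 0 := by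
    intro y hy x hx
    refine B2d y ?_ hy
    rw [← add_sub_cancel (f x) y]
    refine Submodule.add_mem_sup ⟨x, rfl⟩ ?_
    rw [LinearMap.mem_ker, map_sub, hx, sub_self]
  have c2z : ∀ y ∈ C2, ∀ x, l (g x) = l y → y = 0 := by
    intro y hy x hx
    refine C2d y ?_ hy
    rw [← add_sub_cancel (g x) y]
    refine Submodule.add_mem_sup ⟨x, rfl⟩ ?_
    rw [LinearMap.mem_ker, map_sub, hx, sub_self]
  have sA : ∀ x, ∃ x0, (f x0 = 0 ∧ g x0 = 0) ∧ ∃ x1 ∈ K1, ∃ x2 ∈ K2, ∃ x3 ∈ A0,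
      x0 + x1 + x2 + x3 = x := by
    intro x
    obtain ⟨y, hy, x3, hx3, rfl⟩ := A0s x trivial
    obtain ⟨u, v, hu, hv, rfl⟩ := hK y hy
    obtain ⟨u0, hu0, x1, hx1, rfl⟩ := K1s u hu
    obtain ⟨v0, hv0, x2, hx2, rfl⟩ := K2s v hv
    have e1 : f u0 = 0 := hu0.1
    have e2 : g u0 = 0 := hu0.2
    have e3 : f v0 = 0 := hv0.1
    have e4 : g v0 = 0 := hv0.2
    exact ⟨u0 + v0, ⟨by simp [e1, e3], by simp [e2, e4]⟩, x1, hx1, x2, hx2, x3, hx3, by abel⟩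
  have sB : ∀ y, ∃ x2 ∈ K2, ∃ x3 ∈ A0, ∃ y1 ∈ B1, ∃ y2 ∈ B2, f x2 + f x3 + y1 + y2 = y := by
    intro y
    obtain ⟨z, hz, y2, hy2, rfl⟩ := B2s y trivial
    obtain ⟨_, ⟨x, rfl⟩, w, hw, rfl⟩ := Submodule.mem_sup.1 hz
    obtain ⟨_, ⟨x2', hx2', rfl⟩, y1, hy1, rfl⟩ := B1s w hw
    obtain ⟨x0, ⟨hx0, -⟩, x1, hx1, x2, hx2, x3, hx3, rfl⟩ := sA x
    refine ⟨x2 + x2', K2.add_mem hx2 hx2', x3, hx3, y1, hy1, y2, hy2, ?_⟩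
    simp only [map_add, hx0, k1f x1 hx1]
    abel
  have sC : ∀ y, ∃ x1 ∈ K1, ∃ x3 ∈ A0, ∃ y1 ∈ C1, ∃ y2 ∈ C2, g x1 + g x3 + y1 + y2 = y := by
    intro y
    obtain ⟨z, hz, y2, hy2, rfl⟩ := C2s y trivial
    obtain ⟨_, ⟨x, rfl⟩, w, hw, rfl⟩ := Submodule.mem_sup.1 hz
    obtain ⟨_, ⟨x1', hx1', rfl⟩, y1, hy1, rfl⟩ := C1s w hw
    obtain ⟨x0, ⟨-, hx0⟩, x1, hx1, x2, hx2, x3, hx3, rfl⟩ := sA x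
    refine ⟨x1 + x1', K1.add_mem hx1 hx1', x3, hx3, y1, hy1, y2, hy2, ?_⟩
    simp only [map_add, hx0, k2g x2 hx2]
    abel
  have sD : ∀ y, ∃ x3 ∈ A0, ∃ y2 ∈ B2, ∃ z2 ∈ C2, ∃ w ∈ D1, h (f x3) + h y2 + l z2 + w = y := by
    intro y
    obtain ⟨z, hz, w, hw, rfl⟩ := D1s y trivial
    obtain ⟨_, ⟨b, rfl⟩, _, ⟨c, rfl⟩, rfl⟩ := Submodule.mem_sup.1 hz
    obtain ⟨x2, hx2, x3, hx3, y1, hy1, y2, hy2, rfl⟩ := sB b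
    obtain ⟨x1', hx1', x3', hx3', z1, hz1, z2, hz2, rfl⟩ := sC c
    refine ⟨x3 + x3', A0.add_mem hx3 hx3', y2, hy2, z2, hz2, w, hw, ?_⟩
    simp only [map_add, b1h y1 hy1, c1l z1 hz1, comm, k2g x2 hx2, map_zero]
    rw [← comm x1', k1f x1' hx1', map_zero]
    abel
  let φ0 : A →ₗ[k] A × B × C × D := quad LinearMap.id 0 0 0
  let φ1 : A →ₗ[k] A × B × C × D := quad LinearMap.id 0 g 0
  let φ2 : A →ₗ[k] A × B × C × D := quad LinearMap.id f 0 0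
  let φ3 : A →ₗ[k] A × B × C × D := quad LinearMap.id f g (h.comp f)
  let φ4 : B →ₗ[k] A × B × C × D := quad 0 LinearMap.id 0 0
  let φ5 : B →ₗ[k] A × B × C × D := quad 0 LinearMap.id 0 h
  let φ6 : C →ₗ[k] A × B × C × D := quad 0 0 LinearMap.id 0
  let φ7 : C →ₗ[k] A × B × C × D := quad 0 0 LinearMap.id l
  let φ8 : D →ₗ[k] A × B × C × D := quad 0 0 0 LinearMap.id
  let V : Fin 9 → Submodule k (A × B × C × D) :=
    ![Submodule.map φ0 (LinearMap.ker f ⊓ LinearMap.ker g), Submodule.map φ1 K1,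
      Submodule.map φ2 K2, Submodule.map φ3 A0, Submodule.map φ4 B1, Submodule.map φ5 B2,
      Submodule.map φ6 C1, Submodule.map φ7 C2, Submodule.map φ8 D1]
  have hV : ∀ v : Fin 9 → A × B × C × D, (∀ j, v j ∈ V j) → ∃ x0, (f x0 = 0 ∧ g x0 = 0) ∧
      ∃ x1 ∈ K1, ∃ x2 ∈ K2, ∃ x3 ∈ A0, ∃ y1 ∈ B1, ∃ y2 ∈ B2, ∃ z1 ∈ C1, ∃ z2 ∈ C2, ∃ w ∈ D1,
      v = ![(x0, 0, 0, 0), (x1, 0, g x1, 0), (x2, f x2, 0, 0), (x3, f x3, g x3, h (f x3)),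
        (0, y1, 0, 0), (0, y2, 0, h y2), (0, 0, z1, 0), (0, 0, z2, l z2), (0, 0, 0, w)] := by
    intro v hv
    obtain ⟨x0, ⟨hx0, hx0'⟩, e0⟩ := hv 0
    obtain ⟨x1, hx1, e1⟩ := hv 1
    obtain ⟨x2, hx2, e2⟩ := hv 2
    obtain ⟨x3, hx3, e3⟩ := hv 3
    obtain ⟨y1, hy1, e4⟩ := hv 4
    obtain ⟨y2, hy2, e5⟩ := hv 5
    obtain ⟨z1, hz1, e6⟩ := hv 6
    obtain ⟨z2, hz2, e7⟩ := hv 7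
    obtain ⟨w, hw, e8⟩ := hv 8
    refine ⟨x0, ⟨hx0, hx0'⟩, x1, hx1, x2, hx2, x3, hx3, y1, hy1, y2, hy2, z1, hz1, z2, hz2,
      w, hw, ?_⟩
    funext j
    revert j
    exact fin_nine_cases _ e0.symm e1.symm e2.symm e3.symm e4.symm e5.symm e6.symm e7.symm e8.symm
  have hV' : ∀ x0, (f x0 = 0 ∧ g x0 = 0) →
      ∀ x1 ∈ K1, ∀ x2 ∈ K2, ∀ x3 ∈ A0, ∀ y1 ∈ B1, ∀ y2 ∈ B2, ∀ z1 ∈ C1, ∀ z2 ∈ C2, ∀ w ∈ D1,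
      ∀ j, (![(x0, 0, 0, 0), (x1, 0, g x1, 0), (x2, f x2, 0, 0), (x3, f x3, g x3, h (f x3)),
        (0, y1, 0, 0), (0, y2, 0, h y2), (0, 0, z1, 0), (0, 0, z2, l z2), (0, 0, 0, w)] :
          Fin 9 → A × B × C × D) j ∈ V j := by
    intro x0 hx0 x1 hx1 x2 hx2 x3 hx3 y1 hy1 y2 hy2 z1 hz1 z2 hz2 w hw
    exact fin_nine_cases _ ⟨x0, hx0, rfl⟩ ⟨x1, hx1, rfl⟩ ⟨x2, hx2, rfl⟩ ⟨x3, hx3, rfl⟩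
      ⟨y1, hy1, rfl⟩ ⟨y2, hy2, rfl⟩ ⟨z1, hz1, rfl⟩ ⟨z2, hz2, rfl⟩ ⟨w, hw, rfl⟩
  obtain ⟨ι, lab, e, heV, hbas⟩ := exists_bases V
  -- properties of elements of `V j`
  have hprop : ∀ j, ∀ u ∈ V j, (¬ qa j → u.1 = 0) ∧ (¬ qb j → u.2.1 = 0) ∧
      (¬ qc j → u.2.2.1 = 0) ∧ (¬ qd j → u.2.2.2 = 0) ∧ (qa j → f u.1 = u.2.1) ∧
      (qa j → g u.1 = u.2.2.1) ∧ (qb j → h u.2.1 = u.2.2.2) ∧ (qc j → l u.2.2.1 = u.2.2.2) := by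
    apply fin_nine_cases
    · rintro _ ⟨x, ⟨hx, hx'⟩, rfl⟩
      have h1 : f x = 0 := hx
      have h2 : g x = 0 := hx'
      simp [φ0, quad, qa, qb, qc, qd, h1, h2]
    · rintro _ ⟨x, hx, rfl⟩
      have h1 := k1f x hx
      have h2 : l (g x) = 0 := by rw [← comm, h1, map_zero]
      simp [φ1, quad, qa, qb, qc, qd, h1, h2]
    · rintro _ ⟨x, hx, rfl⟩
      have h1 := k2g x hx
      have h2 : h (f x) = 0 := by rw [comm, h1, map_zero]
      simp [φ2, quad, qa, qb, qc, qd, h1, h2]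
    · rintro _ ⟨x, hx, rfl⟩
      simp [φ3, quad, qa, qb, qc, qd, comm]
    · rintro _ ⟨x, hx, rfl⟩
      simp [φ4, quad, qa, qb, qc, qd, b1h x hx]
    · rintro _ ⟨x, hx, rfl⟩
      simp [φ5, quad, qa, qb, qc, qd]
    · rintro _ ⟨x, hx, rfl⟩
      simp [φ6, quad, qa, qb, qc, qd, c1l x hx]
    · rintro _ ⟨x, hx, rfl⟩
      simp [φ7, quad, qa, qb, qc, qd]
    · rintro _ ⟨x, hx, rfl⟩
      simp [φ8, quad, qa, qb, qc, qd]
  have P := fun i => hprop (lab i) (e i) (heV i)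
  refine ⟨ι, lab, fun i => (e i).1, fun i => (e i).2.1, fun i => (e i).2.2.1, fun i => (e i).2.2.2,
    fun i => (P i).1, fun i => (P i).2.1, fun i => (P i).2.2.1, fun i => (P i).2.2.2.1,
    fun i => (P i).2.2.2.2.1, fun i => (P i).2.2.2.2.2.1, fun i => (P i).2.2.2.2.2.2.1,
    fun i => (P i).2.2.2.2.2.2.2, ?_, ?_, ?_, ?_⟩
  · refine hbas A (LinearMap.fst k A (B × C × D)) qa ?_ ?_
    · intro v hv hs
      obtain ⟨x0, hx0, x1, hx1, x2, hx2, x3, hx3, y1, hy1, y2, hy2, z1, hz1, z2, hz2,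
        w, hw, rfl⟩ := hV v hv
      rw [fin_nine_sum] at hs
      have hs : x0 + x1 + x2 + x3 + 0 + 0 + 0 + 0 + 0 = 0 := hs
      simp only [add_zero] at hs
      have e3 : x3 = 0 := by
        apply a0z x3 hx3
        have := congrArg (fun x => h (f x)) hs
        simp only [map_add, hx0.1, k1f x1 hx1, map_zero, zero_add] at this
        rwa [comm x2, k2g x2 hx2, map_zero, zero_add] at this
      subst e3
      have e2 : x2 = 0 := by
        apply k2z x2 hx2
        have := congrArg f hs
        simpa only [map_add, hx0.1, k1f x1 hx1, map_zero, zero_add, add_zero] using this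
      subst e2
      have e1 : x1 = 0 := by
        apply k1z x1 hx1
        have := congrArg g hs
        simpa only [map_add, hx0.2, map_zero, zero_add, add_zero] using this
      subst e1
      have e0 : x0 = 0 := by simpa using hs
      subst e0
      rintro j (rfl | rfl | rfl | rfl) <;> simp
    · intro w
      obtain ⟨x0, hx0, x1, hx1, x2, hx2, x3, hx3, rfl⟩ := sA w
      refine ⟨_, hV' x0 hx0 x1 hx1 x2 hx2 x3 hx3 0 (zero_mem _) 0 (zero_mem _) 0 (zero_mem _)
        0 (zero_mem _) 0 (zero_mem _), ?_⟩
      rw [fin_nine_sum]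
      show x0 + x1 + x2 + x3 + 0 + 0 + 0 + 0 + 0 = _
      simp
  · refine hbas B ((LinearMap.fst k B (C × D)).comp (LinearMap.snd k A (B × C × D))) qb ?_ ?_
    · intro v hv hs
      obtain ⟨x0, hx0, x1, hx1, x2, hx2, x3, hx3, y1, hy1, y2, hy2, z1, hz1, z2, hz2,
        w, hw, rfl⟩ := hV v hv
      rw [fin_nine_sum] at hs
      have hs : 0 + 0 + f x2 + f x3 + y1 + y2 + 0 + 0 + 0 = 0 := hs
      simp only [add_zero, zero_add] at hs
      have hh := congrArg h hs
      simp only [map_add, b1h y1 hy1, map_zero, add_zero] at hh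
      rw [comm x2, k2g x2 hx2, map_zero, zero_add] at hh
      have e5 : y2 = 0 := by
        refine b2z y2 hy2 (-x3) ?_
        rw [map_neg, map_neg]
        exact neg_eq_of_add_eq_zero_right hh
      subst e5
      have e3 : x3 = 0 := by
        apply a0z x3 hx3
        simpa using hh
      subst e3
      simp only [map_zero, add_zero] at hs
      have e4 : y1 = 0 := by
        refine B1d y1 ⟨-x2, K2.neg_mem hx2, ?_⟩ hy1
        rw [map_neg]
        exact neg_eq_of_add_eq_zero_right hs
      subst e4
      have e2 : x2 = 0 := k2z x2 hx2 (by simpa using hs)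
      subst e2
      rintro j (rfl | rfl | rfl | rfl) <;> simp
    · intro w
      obtain ⟨x2, hx2, x3, hx3, y1, hy1, y2, hy2, rfl⟩ := sB w
      refine ⟨_, hV' 0 ⟨map_zero _, map_zero _⟩ 0 (zero_mem _) x2 hx2 x3 hx3 y1 hy1 y2 hy2
        0 (zero_mem _) 0 (zero_mem _) 0 (zero_mem _), ?_⟩
      rw [fin_nine_sum]
      show 0 + 0 + f x2 + f x3 + y1 + y2 + 0 + 0 + 0 = _
      simp
  · refine hbas C ((LinearMap.fst k C D).comp ((LinearMap.snd k B (C × D)).comp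
      (LinearMap.snd k A (B × C × D)))) qc ?_ ?_
    · intro v hv hs
      obtain ⟨x0, hx0, x1, hx1, x2, hx2, x3, hx3, y1, hy1, y2, hy2, z1, hz1, z2, hz2,
        w, hw, rfl⟩ := hV v hv
      rw [fin_nine_sum] at hs
      have hs : 0 + g x1 + 0 + g x3 + 0 + 0 + z1 + z2 + 0 = 0 := hs
      simp only [add_zero, zero_add] at hs
      have hh := congrArg l hs
      simp only [map_add, c1l z1 hz1, map_zero, add_zero] at hh
      rw [← comm x1, k1f x1 hx1, map_zero, zero_add] at hh
      have e5 : z2 = 0 := by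
        refine c2z z2 hz2 (-x3) ?_
        rw [map_neg, map_neg]
        exact neg_eq_of_add_eq_zero_right hh
      subst e5
      have e3 : x3 = 0 := by
        apply a0z x3 hx3
        rw [comm]
        simpa using hh
      subst e3
      simp only [map_zero, add_zero] at hs
      have e4 : z1 = 0 := by
        refine C1d z1 ⟨-x1, K1.neg_mem hx1, ?_⟩ hz1
        rw [map_neg]
        exact neg_eq_of_add_eq_zero_right hs
      subst e4
      have e2 : x1 = 0 := k1z x1 hx1 (by simpa using hs)
      subst e2
      rintro j (rfl | rfl | rfl | rfl) <;> simp
    · intro w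
      obtain ⟨x1, hx1, x3, hx3, z1, hz1, z2, hz2, rfl⟩ := sC w
      refine ⟨_, hV' 0 ⟨map_zero _, map_zero _⟩ x1 hx1 0 (zero_mem _) x3 hx3 0 (zero_mem _)
        0 (zero_mem _) z1 hz1 z2 hz2 0 (zero_mem _), ?_⟩
      rw [fin_nine_sum]
      show 0 + g x1 + 0 + g x3 + 0 + 0 + z1 + z2 + 0 = _
      simp
  · refine hbas D ((LinearMap.snd k C D).comp ((LinearMap.snd k B (C × D)).comp
      (LinearMap.snd k A (B × C × D)))) qd ?_ ?_
    · intro v hv hs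
      obtain ⟨x0, hx0, x1, hx1, x2, hx2, x3, hx3, y1, hy1, y2, hy2, z1, hz1, z2, hz2,
        w, hw, rfl⟩ := hV v hv
      rw [fin_nine_sum] at hs
      have hs : 0 + 0 + 0 + h (f x3) + 0 + h y2 + 0 + l z2 + w = 0 := hs
      simp only [add_zero, zero_add] at hs
      have e8 : w = 0 := by
        refine D1d w ?_ hw
        have : w = h (-(f x3 + y2)) + l (-z2) := by
          simp only [map_neg, map_add]
          rw [← neg_eq_of_add_eq_zero_right hs]
          abel
        rw [this]
        exact Submodule.add_mem_sup ⟨_, rfl⟩ ⟨_, rfl⟩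
      subst e8
      rw [add_zero] at hs
      have e5 : y2 = 0 := by
        obtain ⟨x, hx⟩ := hI (f x3 + y2) (-z2) (by
          rw [map_add, map_neg]; exact eq_neg_of_add_eq_zero_left hs)
        refine b2z y2 hy2 (x - x3) ?_
        rw [map_sub, map_sub, hx, map_add, add_sub_cancel_left]
      subst e5
      rw [map_zero, add_zero] at hs
      have e7 : z2 = 0 := by
        refine c2z z2 hz2 (-x3) ?_
        rw [map_neg, map_neg, ← comm]
        exact neg_eq_of_add_eq_zero_right hs
      subst e7
      have e3 : x3 = 0 := a0z x3 hx3 (by simpa using hs)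
      subst e3
      rintro j (rfl | rfl | rfl | rfl) <;> simp
    · intro w
      obtain ⟨x3, hx3, y2, hy2, z2, hz2, w, hw, rfl⟩ := sD w
      refine ⟨_, hV' 0 ⟨map_zero _, map_zero _⟩ 0 (zero_mem _) 0 (zero_mem _) x3 hx3 0 (zero_mem _)
        y2 hy2 0 (zero_mem _) z2 hz2 w hw, ?_⟩
      rw [fin_nine_sum]
      show 0 + 0 + 0 + h (f x3) + 0 + h y2 + 0 + l z2 + w = _
      simp

end Helpers3
end PersistencePaper
namespace PersistencePaper

section Helpers4

variable {k : Type} [Field k]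

theorem rho_self_s11 {P : Type} [Preorder P] (N : PersistenceModule k P) {t : P} (h : t ≤ t)
    (x : N.obj t) : rho k N h x = x := by
  have : N.map (homOfLE h) = 𝟙 _ := N.map_id t
  exact congrArg (fun f => f.hom x) this

theorem rho_rho {P : Type} [Preorder P] (N : PersistenceModule k P) {r s t : P} (h : r ≤ s)
    (h' : s ≤ t) (h'' : r ≤ t) (x : N.obj r) : rho k N h' (rho k N h x) = rho k N h'' x := by
  have : N.map (homOfLE h'') = N.map (homOfLE h) ≫ N.map (homOfLE h') := by
    rw [← N.map_comp]; rfl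
  exact congrArg (fun f => f.hom x) this.symm

def Rset {P : Type} (a b c d : P) (j : Fin 9) : Set P :=
  {p | (p = a ∧ qa j) ∨ (p = b ∧ b ≠ a ∧ qb j) ∨ (p = c ∧ c ≠ a ∧ qc j) ∨
    (p = d ∧ d ≠ a ∧ d ≠ b ∧ d ≠ c ∧ qd j)}

theorem q_fact : ∀ j, qa j → qd j → qb j ∧ qc j := by
  unfold qa qb qc qd
  decide

theorem q_fact2 : ∀ j, qa j → ¬ qb j → ¬ qd j := by
  unfold qa qb qd
  decide

theorem square_good {P : Type} [PartialOrder P] (N : PersistenceModule k P) {a b c d : P}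
    (hall : ∀ x, x = a ∨ x = b ∨ x = c ∨ x = d)
    (hab : a ≤ b) (hac : a ≤ c) (hbd : b ≤ d) (hcd : c ≤ d) (had : a ≤ d)
    (hbc : b ≤ c → b = a) (hcb : c ≤ b → c = a)
    (hI : LinearMap.range (rho k N had) =
      LinearMap.range (rho k N hbd) ⊓ LinearMap.range (rho k N hcd))
    (hK : LinearMap.ker (rho k N had) = LinearMap.ker (rho k N hab) ⊔ LinearMap.ker (rho k N hac)) :
    (∀ j, (Rset a b c d j).OrdConnected) ∧
    ∃ (ι : Type) (lab : ι → Fin 9) (e : ι → ∀ t, N.obj t),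
      Good N (fun i => Rset a b c d (lab i)) e := by
  have cls : ∀ x, x = a ∨ (x = b ∧ b ≠ a) ∨ (x = c ∧ c ≠ a) ∨
      (x = d ∧ d ≠ a ∧ d ≠ b ∧ d ≠ c) := by
    intro x
    have := hall x
    grind
  have ma : ∀ j, a ∈ Rset a b c d j ↔ qa j := by
    intro j
    simp only [Rset, Set.mem_ofPred_eq]
    grind
  have mb : b ≠ a → ∀ j, b ∈ Rset a b c d j ↔ qb j := by
    intro hb j
    have : b ≠ c := fun h => hb (hbc h.le)
    simp only [Rset, Set.mem_ofPred_eq]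
    grind
  have mc : c ≠ a → ∀ j, c ∈ Rset a b c d j ↔ qc j := by
    intro hb j
    have : c ≠ b := fun h => hb (hcb h.le)
    simp only [Rset, Set.mem_ofPred_eq]
    grind
  have md : d ≠ a → d ≠ b → d ≠ c → ∀ j, d ∈ Rset a b c d j ↔ qd j := by
    intro h1 h2 h3 j
    simp only [Rset, Set.mem_ofPred_eq]
    grind
  have na : ∀ x, x ≤ a → x = a := by
    intro x hx
    rcases hall x with rfl | rfl | rfl | rfl
    · rfl
    · exact le_antisymm hx hab
    · exact le_antisymm hx hac
    · exact le_antisymm hx had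
  have nd : ∀ x, d ≤ x → x = d := by
    intro x hx
    rcases hall x with rfl | rfl | rfl | rfl
    · exact le_antisymm had hx
    · exact le_antisymm hbd hx
    · exact le_antisymm hcd hx
    · rfl
  constructor
  · intro j
    constructor
    intro x hx y hy z hz
    obtain ⟨hxz, hzy⟩ := hz
    rcases cls z with rfl | ⟨rfl, hz⟩ | ⟨rfl, hz⟩ | ⟨rfl, h1, h2, h3⟩
    · rw [na x hxz] at hx; exact hx
    · rw [mb hz]
      rcases cls x with rfl | ⟨rfl, h'⟩ | ⟨rfl, h'⟩ | ⟨rfl, h1, h2, h3⟩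
      · rcases cls y with rfl | ⟨rfl, h''⟩ | ⟨rfl, h''⟩ | ⟨rfl, h1, h2, h3⟩
        · exact absurd (na _ hzy) hz
        · rwa [mb hz] at hy
        · exact absurd (hbc hzy) hz
        · rw [ma] at hx; rw [md h1 h2 h3] at hy
          exact (q_fact j hx hy).1
      · rwa [mb hz] at hx
      · exact absurd (hcb hxz) h'
      · exact absurd (nd _ hxz).symm h2
    · rw [mc hz]
      rcases cls x with rfl | ⟨rfl, h'⟩ | ⟨rfl, h'⟩ | ⟨rfl, h1, h2, h3⟩
      · rcases cls y with rfl | ⟨rfl, h''⟩ | ⟨rfl, h''⟩ | ⟨rfl, h1, h2, h3⟩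
        · exact absurd (na _ hzy) hz
        · exact absurd (hcb hzy) hz
        · rwa [mc hz] at hy
        · rw [ma] at hx; rw [md h1 h2 h3] at hy
          exact (q_fact j hx hy).2
      · exact absurd (hbc hxz) h'
      · rwa [mc hz] at hx
      · exact absurd (nd _ hxz).symm h3
    · rw [nd y hzy] at hy; exact hy
  obtain ⟨ι, lab, ea, eb, ec, ed, za, zb, zc, zd, hf, hg, hh, hl, Ba, Bb, Bc, Bd⟩ :=
    square_bases (rho k N hab) (rho k N hac) (rho k N hbd) (rho k N hcd)
      (fun x => by rw [rho_rho N hab hbd had, rho_rho N hac hcd had])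
      (by
        intro y z hyz
        have : rho k N hbd y ∈ LinearMap.range (rho k N had) := by
          rw [hI]; exact ⟨⟨y, rfl⟩, ⟨z, hyz.symm⟩⟩
        obtain ⟨x, hx⟩ := this
        exact ⟨x, by rw [rho_rho N hab hbd had, hx]⟩)
      (by
        intro x hx
        rw [rho_rho N hab hbd had, ← LinearMap.mem_ker, hK] at hx
        obtain ⟨y, hy, z, hz, h⟩ := Submodule.mem_sup.1 hx
        exact ⟨y, z, hy, hz, h⟩)
  let E : ι → ∀ t, N.obj t := fun i x =>
    if h : x = a then rho k N h.ge (ea i) else if h : x = b then rho k N h.ge (eb i) else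
    if h : x = c then rho k N h.ge (ec i) else if h : x = d then rho k N h.ge (ed i) else 0
  have Ea : ∀ i, E i a = ea i := by
    intro i
    simp only [E, dif_pos]
    exact rho_self_s11 N _ _
  have Eb : b ≠ a → ∀ i, E i b = eb i := by
    intro hb i
    simp only [E, dif_neg hb, dif_pos]
    exact rho_self_s11 N _ _
  have Ec : c ≠ a → ∀ i, E i c = ec i := by
    intro hc i
    have : c ≠ b := fun h => hc (hcb h.le)
    simp only [E, dif_neg hc, dif_neg this, dif_pos]
    exact rho_self_s11 N _ _
  have Ed : d ≠ a → d ≠ b → d ≠ c → ∀ i, E i d = ed i := by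
    intro h1 h2 h3 i
    simp only [E, dif_neg h1, dif_neg h2, dif_neg h3, dif_pos]
    exact rho_self_s11 N _ _
  refine ⟨ι, lab, E, ?_, ?_, ?_, ?_⟩
  · intro i t ht
    rcases cls t with rfl | ⟨rfl, hz⟩ | ⟨rfl, hz⟩ | ⟨rfl, h1, h2, h3⟩
    · rw [Ea]; exact za i (by rwa [ma] at ht)
    · rw [Eb hz]; exact zb i (by rwa [mb hz] at ht)
    · rw [Ec hz]; exact zc i (by rwa [mc hz] at ht)
    · rw [Ed h1 h2 h3]; exact zd i (by rwa [md h1 h2 h3] at ht)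
  · intro i x y hxy hx
    rcases cls x with rfl | ⟨rfl, h'⟩ | ⟨rfl, h'⟩ | ⟨rfl, h1, h2, h3⟩
    · rw [ma] at hx
      rcases cls y with rfl | ⟨rfl, h''⟩ | ⟨rfl, h''⟩ | ⟨rfl, h1, h2, h3⟩
      · exact rho_self_s11 N _ _
      · rw [Ea, Eb h'', hf i hx]
      · rw [Ea, Ec h'', hg i hx]
      · rw [Ea, Ed h1 h2 h3, ← rho_rho N hab hbd, hf i hx]
        by_cases hq : qb (lab i)
        · exact hh i hq
        · rw [zb i hq, zd i (q_fact2 _ hx hq), map_zero]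
    · rcases cls y with rfl | ⟨rfl, h''⟩ | ⟨rfl, h''⟩ | ⟨rfl, h1, h2, h3⟩
      · exact absurd (na _ hxy) h'
      · exact rho_self_s11 N _ _
      · exact absurd (hbc hxy) h'
      · rw [mb h'] at hx
        rw [Eb h', Ed h1 h2 h3, hh i hx]
    · rcases cls y with rfl | ⟨rfl, h''⟩ | ⟨rfl, h''⟩ | ⟨rfl, h1, h2, h3⟩
      · exact absurd (na _ hxy) h'
      · exact absurd (hcb hxy) h'
      · exact rho_self_s11 N _ _
      · rw [mc h'] at hx
        rw [Ec h', Ed h1 h2 h3, hl i hx]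
    · obtain rfl := nd y hxy
      exact rho_self_s11 N _ _
  · intro t x hx i hi
    rcases cls t with rfl | ⟨rfl, hz⟩ | ⟨rfl, hz⟩ | ⟨rfl, h1, h2, h3⟩
    · simp only [Ea] at hx; exact Ba.1 x hx i (by rwa [ma] at hi)
    · simp only [Eb hz] at hx; exact Bb.1 x hx i (by rwa [mb hz] at hi)
    · simp only [Ec hz] at hx; exact Bc.1 x hx i (by rwa [mc hz] at hi)
    · simp only [Ed h1 h2 h3] at hx; exact Bd.1 x hx i (by rwa [md h1 h2 h3] at hi)
  · intro t
    rcases cls t with rfl | ⟨rfl, hz⟩ | ⟨rfl, hz⟩ | ⟨rfl, h1, h2, h3⟩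
    · simp only [Ea]; exact Ba.2
    · simp only [Eb hz]; exact Bb.2
    · simp only [Ec hz]; exact Bc.2
    · simp only [Ed h1 h2 h3]; exact Bd.2

theorem Good.drop_empty {P : Type} [Preorder P] {N : PersistenceModule k P} {ι : Type}
    {Q : ι → Set P} {e : ι → ∀ t, N.obj t} (h : Good N Q e) :
    Good N (fun i : {i // (Q i).Nonempty} => Q i.1) (fun i => e i.1) := by
  obtain ⟨h1, h2, h3, h4⟩ := h
  refine ⟨fun i => h1 i.1, fun i => h2 i.1, ?_, ?_⟩
  · intro t x hx i hi
    have := h3 t (Finsupp.mapDomain Subtype.val x) (by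
      rw [Finsupp.linearCombination_mapDomain]; exact hx) i.1 hi
    rwa [Finsupp.mapDomain_apply Subtype.val_injective] at this
  · intro t
    rw [← top_le_iff, ← h4 t, Submodule.span_le]
    rintro _ ⟨i, rfl⟩
    by_cases ht : t ∈ Q i
    · exact Submodule.subset_span ⟨⟨i, t, ht⟩, rfl⟩
    · simp only [h1 i t ht]; exact Submodule.zero_mem _

theorem Rset_rect {P : Type} {a b c d : P} (j : Fin 9) (hne : (Rset a b c d j).Nonempty)
    (h1 : b = a → c = d) (h2 : c = a → b = d) (h3 : d = c → b = a) (h4 : d = b → c = a)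
    (h5 : d = a → b = a) (h6 : d = a → c = a) :
    Rset a b c d j ∈ ({{a}, {b}, {c}, {d}, {a, b}, {a, c}, {b, d}, {c, d},
      {a, b, c, d}} : Set (Set P)) := by
  have key : ∀ R : Set P, (∀ p, p ∈ Rset a b c d j ↔ p ∈ R) → Rset a b c d j = R :=
    fun R h => Set.ext h
  obtain ⟨p0, hp0⟩ := hne
  simp only [Set.mem_insert_iff, Set.mem_singleton_iff]
  revert hp0 key
  revert j
  apply fin_nine_cases
  all_goals
    intro key hp0
    simp only [Rset, Set.mem_ofPred_eq, qa, qb, qc, qd, Fin.reduceEq, or_false, false_or, or_true,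
      true_or, and_true, and_false] at hp0 key ⊢
  · left; apply key; intro p; simp
  · right; right; right; right; right; left; apply key; intro p; simp; grind
  · right; right; right; right; left; apply key; intro p; simp; grind
  · right; right; right; right; right; right; right; right; apply key; intro p; simp; grind
  · right; left; apply key; intro p; simp; grind
  · right; right; right; right; right; right; left; apply key; intro p; simp; grind
  · right; right; left; apply key; intro p; simp; grind
  · right; right; right; right; right; right; right; left; apply key; intro p; simp; grind
  · right; right; right; left; apply key; intro p; simp; grind

theorem nine_closed {X Y : Type} (s t : X × Y) (R : Set (X × Y))
    (hR : R ∈ ({{s}, {(t.1, s.2)}, {(s.1, t.2)}, {t},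
              {s, (t.1, s.2)}, {s, (s.1, t.2)}, {(t.1, s.2), t}, {(s.1, t.2), t},
              {s, (t.1, s.2), (s.1, t.2), t}} : Set (Set (X × Y)))) :
    ((t.1, s.2) ∈ R → (s.1, t.2) ∈ R → t ∈ R → s ∈ R) ∧
    (s ∈ R → (t.1, s.2) ∈ R → (s.1, t.2) ∈ R → t ∈ R) := by
  obtain ⟨s1, s2⟩ := s
  obtain ⟨t1, t2⟩ := t
  simp only [Set.mem_insert_iff, Set.mem_singleton_iff] at hR
  rcases hR with rfl | rfl | rfl | rfl | rfl | rfl | rfl | rfl | rfl <;>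
    simp only [Set.mem_insert_iff, Set.mem_singleton_iff, Prod.mk.injEq] <;> grind

end Helpers4
end PersistencePaper
namespace PersistencePaper

/-- A pfd persistence module over a finite grid is weakly exact if and
only if its restriction to every square `{s, (t₁,s₂), (s₁,t₂), t}` (for `s ≤ t`)
decomposes as a direct sum of indicator modules of rectangles of that square. -/
theorem weaklyExact_iff_locally_rectangleDecomposable (k : Type) [Field k]
    (X Y : Type) [LinearOrder X] [LinearOrder Y] [Fintype X] [Fintype Y]
    (M : PersistenceModule k (X × Y)) (hpfd : Pfd k M) :
    WeaklyExact k M ↔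
      ∀ s t : X × Y, s ≤ t →
        DecomposesWithSupports k
          (restrict k M ({s, (t.1, s.2), (s.1, t.2), t} : Set (X × Y)))
          {Q | Subtype.val '' Q ∈
            ({{s}, {(t.1, s.2)}, {(s.1, t.2)}, {t},
              {s, (t.1, s.2)}, {s, (s.1, t.2)}, {(t.1, s.2), t}, {(s.1, t.2), t},
              {s, (t.1, s.2), (s.1, t.2), t}} : Set (Set (X × Y)))} := by
  constructor
  · intro hM s t hst
    obtain ⟨hI, hK⟩ := hM s t hst
    let S : Set (X × Y) := {s, (t.1, s.2), (s.1, t.2), t}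
    let a : S := ⟨s, by simp [S]⟩
    let b : S := ⟨(t.1, s.2), by simp [S]⟩
    let c : S := ⟨(s.1, t.2), by simp [S]⟩
    let d : S := ⟨t, by simp [S]⟩
    have ab : a ≤ b := (show s ≤ (t.1, s.2) from ⟨hst.1, le_refl s.2⟩)
    have ac : a ≤ c := (show s ≤ (s.1, t.2) from ⟨le_refl s.1, hst.2⟩)
    have bd : b ≤ d := (show (t.1, s.2) ≤ t from ⟨le_refl t.1, hst.2⟩)
    have cd : c ≤ d := (show (s.1, t.2) ≤ t from ⟨hst.1, le_refl t.2⟩)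
    have ad : a ≤ d := hst
    have beq : ∀ {x y : S}, x = y ↔ x.1.1 = y.1.1 ∧ x.1.2 = y.1.2 := by
      intro x y
      rw [Subtype.ext_iff, Prod.ext_iff]
    obtain ⟨hconv, ι, lab, e, hG⟩ := square_good (restrict k M S) (a := a) (b := b) (c := c) (d := d)
      (by
        rintro ⟨x, hx⟩
        simp only [S, Set.mem_insert_iff, Set.mem_singleton_iff] at hx
        simpa only [a, b, c, d, Subtype.mk.injEq] using hx)
      ab ac bd cd ad
      (fun h => beq.2 ⟨le_antisymm h.1 hst.1, rfl⟩)
      (fun h => beq.2 ⟨rfl, le_antisymm h.2 hst.2⟩) hI hK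
    refine ⟨{i // (Rset a b c d (lab i)).Nonempty}, fun i => Rset a b c d (lab i.1), ?_,
      fun i => hconv (lab i.1), iso_of_good _ _ _ _ hG.drop_empty⟩
    intro i
    have h9 := Rset_rect (lab i.1) i.2
      (fun h => beq.2 ⟨(beq.1 h).1.symm, rfl⟩)
      (fun h => beq.2 ⟨rfl, (beq.1 h).2.symm⟩)
      (fun h => beq.2 ⟨(beq.1 h).1, rfl⟩)
      (fun h => beq.2 ⟨rfl, (beq.1 h).2⟩)
      (fun h => beq.2 ⟨(beq.1 h).1, rfl⟩)
      (fun h => beq.2 ⟨rfl, (beq.1 h).2⟩)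
    simp only [Set.mem_insert_iff, Set.mem_singleton_iff] at h9
    show Subtype.val '' Rset a b c d (lab i.1) ∈
      ({{s}, {(t.1, s.2)}, {(s.1, t.2)}, {t},
        {s, (t.1, s.2)}, {s, (s.1, t.2)}, {(t.1, s.2), t}, {(s.1, t.2), t},
        {s, (t.1, s.2), (s.1, t.2), t}} : Set (Set (X × Y)))
    simp only [Set.mem_insert_iff, Set.mem_singleton_iff]
    rcases h9 with h | h | h | h | h | h | h | h | h <;> rw [h] <;>
      simp [Set.image_insert_eq, Set.image_singleton, a, b, c, d]
  · intro H s t hst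
    obtain ⟨ι, Q, hA, hconv, ⟨φ⟩⟩ := H s t hst
    obtain ⟨e, hG⟩ := good_of_iso _ Q hconv φ
    let S : Set (X × Y) := {s, (t.1, s.2), (s.1, t.2), t}
    let a : S := ⟨s, by simp [S]⟩
    let b : S := ⟨(t.1, s.2), by simp [S]⟩
    let c : S := ⟨(s.1, t.2), by simp [S]⟩
    let d : S := ⟨t, by simp [S]⟩
    have ab : a ≤ b := (show s ≤ (t.1, s.2) from ⟨hst.1, le_refl s.2⟩)
    have ac : a ≤ c := (show s ≤ (s.1, t.2) from ⟨le_refl s.1, hst.2⟩)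
    have bd : b ≤ d := (show (t.1, s.2) ≤ t from ⟨le_refl t.1, hst.2⟩)
    have cd : c ≤ d := (show (s.1, t.2) ≤ t from ⟨hst.1, le_refl t.2⟩)
    have ad : a ≤ d := hst
    have mem : ∀ i (x : S), x ∈ Q i ↔ x.1 ∈ Subtype.val '' Q i := fun i x =>
      (Subtype.val_injective.mem_set_image).symm
    refine hG.exact (a := a) (b := b) (c := c) (d := d) ab ac bd cd ad ?_ ?_
    · intro i
      rw [mem, mem, mem, mem]
      exact (nine_closed s t _ (hA i)).1
    · intro i
      rw [mem, mem, mem, mem]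
      exact (nine_closed s t _ (hA i)).2

end PersistencePaper
end
end

section
/- Let n ≥ 2 and let L_n be the pointwise right Kan extension of V_n along the order embedding φ : D_n ↪ [1,n+1]² defined by φ(i) = (i, n+2−i) for i ∈ {1, …, n+1} and φ(n+2) = (n+1, n+1). Then: (1) L_n is not interval-decomposable; (2) for any strict subgrid X' × Y' ⊊ [1,n+1]² (X' ⊆ {1,…,n+1}, Y' ⊆ {1,…,n+1}, X' × Y' ≠ [1,n+1]²), the restriction of L_n to X' × Y' is interval-decomposable. -/
open CategoryTheory Limits Set

noncomputable section

set_option linter.unusedSectionVars false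

attribute [local instance] Classical.propDecidable

namespace PersistencePaper

/-- The poset `D_n`: the elements `0, …, n` of `Fin (n+2)` (representing `1, …, n+1`) are
pairwise-incomparable minimal elements, all lying below the single maximal element
`Fin.last (n+1)` (representing `n+2`). -/
def DPos (n : ℕ) : Type := Fin (n + 2)

instance (n : ℕ) : PartialOrder (DPos n) where
  le i j := i = j ∨ j = Fin.last (n + 1)
  le_refl i := Or.inl rfl
  le_trans i j l h1 h2 := by
    rcases h1 with rfl | h1
    · exact h2
    · rcases h2 with rfl | h2
      · exact Or.inr h1
      · exact Or.inr h2
  le_antisymm i j h1 h2 := by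
    rcases h1 with rfl | h1
    · rfl
    · rcases h2 with rfl | h2
      · rfl
      · exact h2.trans h1.symm

theorem DPos.le_def {n : ℕ} (i j : DPos n) : i ≤ j ↔ i = j ∨ j = Fin.last (n + 1) :=
  Iff.rfl

/-- The space of the module `V_n` at the vertex `i` of `D_n`, realized as a submodule of
`k^n`: the `i`-th coordinate axis `k·eᵢ` for each of the first `n` minimal vertices, the
diagonal line `k·(1,…,1)` for the last minimal vertex, and all of `k^n` at the maximal
vertex.  The structure maps of `V_n` are the inclusions, i.e. the inclusions `ιᵢ` of the
coordinate axes and the diagonal embedding `δ_n`. -/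
def Vsub (k : Type) [Field k] (n : ℕ) (i : DPos n) : Submodule k (Fin n → k) :=
  if i = Fin.last (n + 1) then ⊤
  else if h : (i : Fin (n + 2)).1 < n then
    Submodule.span k {Pi.single (⟨(i : Fin (n + 2)).1, h⟩ : Fin n) (1 : k)}
  else Submodule.span k {(fun _ => 1 : Fin n → k)}

theorem Vsub_mono (k : Type) [Field k] (n : ℕ) {i j : DPos n} (h : i ≤ j) :
    Vsub k n i ≤ Vsub k n j := by
  rcases (DPos.le_def i j).mp h with rfl | h
  · exact le_rfl
  · have ht : Vsub k n j = ⊤ := by rw [Vsub, if_pos h]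
    rw [ht]
    exact le_top

/-- The persistence module `V_n` over `D_n`. -/
def Vmod (k : Type) [Field k] (n : ℕ) : PersistenceModule k (DPos n) where
  obj i := ModuleCat.of k (Vsub k n i)
  map {i j} f := ModuleCat.ofHom (Submodule.inclusion (Vsub_mono k n (leOfHom f)))
  map_id _ := rfl
  map_comp _ _ := rfl

/-- The order embedding `φ : D_n ↪ [1,n+1]²` (in 0-indexed coordinates):
`φ(i) = (i, n−i)` for the minimal vertices `i ∈ {0,…,n}` of `D_n`, and
`φ(max) = (n, n)`. -/
def phi (n : ℕ) (i : DPos n) : Fin (n + 1) × Fin (n + 1) :=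
  if hlast : (i : Fin (n + 2)) = Fin.last (n + 1) then (Fin.last n, Fin.last n)
  else
    have hlt : (i : Fin (n + 2)).1 < n + 1 := by
      have h2 := (i : Fin (n + 2)).2
      by_contra hge
      exact hlast (Fin.ext (show (i : Fin (n + 2)).1 = n + 1 by omega))
    (⟨(i : Fin (n + 2)).1, hlt⟩, ⟨n - (i : Fin (n + 2)).1, by omega⟩)

theorem phi_mono (n : ℕ) : Monotone (phi n) := by
  intro i j h
  rcases (DPos.le_def i j).mp h with rfl | h
  · exact le_rfl
  · have ht : phi n j = (Fin.last n, Fin.last n) := by rw [phi, dif_pos h]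
    rw [ht]
    exact ⟨Fin.le_last _, Fin.le_last _⟩

section Helpers

/-- The functor associated with a monotone family of submodules. -/
def subFun {k : Type} [Field k] {E : Type} [AddCommGroup E] [Module k E] {P : Type} [Preorder P]
    (W : P → Submodule k E) (hW : Monotone W) : PersistenceModule k P where
  obj p := ModuleCat.of k (W p)
  map {_ _} f := ModuleCat.ofHom (Submodule.inclusion (hW (leOfHom f)))
  map_id _ := rfl
  map_comp _ _ := rfl

theorem intervalDecomposable_of_iso {k : Type} [Field k] {P : Type} [Preorder P]
    {M N : PersistenceModule k P} (e : M ≅ N) (h : IntervalDecomposable k N) :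
    IntervalDecomposable k M := by
  obtain ⟨ι, I, hI, ⟨f⟩⟩ := h
  exact ⟨ι, I, hI, ⟨e ≪≫ f⟩⟩

section Sum
variable {k : Type} [Field k] {E : Type} [AddCommGroup E] [Module k E] {P : Type} [Preorder P]
    (W : P → Submodule k E) (hW : Monotone W)

def inj (U : Set P) (hU : U.OrdConnected) (hup : IsUpperSet U) (b : E)
    (h1 : ∀ p ∈ U, b ∈ W p) : indicator k U hU ⟶ subFun W hW where
  app p := ModuleCat.ofHom
    { toFun := fun x : indSub k U p => (⟨(x : k) • b, by
        by_cases hp : p ∈ U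
        · exact (W p).smul_mem _ (h1 p hp)
        · rw [x.2 hp, zero_smul]; exact (W p).zero_mem⟩ : W p)
      map_add' := fun x y => Subtype.ext (add_smul (x : k) (y : k) b)
      map_smul' := fun c x => Subtype.ext (mul_smul c (x : k) b) }
  naturality p q f := by
    refine ModuleCat.hom_ext (LinearMap.ext fun x => Subtype.ext ?_)
    have key : ∀ x : indSub k U p,
        ((indMap k U p q x : indSub k U q) : k) • b = (Subtype.val x : k) • b := by
      intro x
      rw [indMap_coe]
      split_ifs with h
      · rfl
      · by_cases hp : p ∈ U
        · exact absurd ⟨hp, hup (leOfHom f) hp⟩ h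
        · rw [x.2 hp]
    exact key x

def prj (U : Set P) (hU : U.OrdConnected) (hup : IsUpperSet U) (c : E →ₗ[k] k)
    (h2 : ∀ p, p ∉ U → ∀ x ∈ W p, c x = 0) : subFun W hW ⟶ indicator k U hU where
  app p := ModuleCat.ofHom
    { toFun := fun x : W p => (⟨c x, fun hp => h2 p hp x x.2⟩ : indSub k U p)
      map_add' := fun x y => Subtype.ext (c.map_add x y)
      map_smul' := fun r x => Subtype.ext (c.map_smul r x) }
  naturality p q f := by
    refine ModuleCat.hom_ext (LinearMap.ext fun x => Subtype.ext ?_)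
    show c (Subtype.val x) = ((indMap k U p q ⟨c (Subtype.val x), _⟩ : indSub k U q) : k)
    rw [indMap_coe]
    split_ifs with h
    · rfl
    · by_cases hp : p ∈ U
      · exact absurd ⟨hp, hup (leOfHom f) hp⟩ h
      · exact h2 p hp _ x.2

theorem prj_inj (U : Set P) (hU : U.OrdConnected) (hup : IsUpperSet U) (b : E)
    (h1 : ∀ p ∈ U, b ∈ W p) (c : E →ₗ[k] k) (h2 : ∀ p, p ∉ U → ∀ x ∈ W p, c x = 0)
    (p : P) (x : W p) :
    Subtype.val (((prj W hW U hU hup c h2 ≫ inj W hW U hU hup b h1).app p).hom x : W p)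
      = c x • b := rfl

theorem inj_prj (U U' : Set P) (hU : U.OrdConnected) (hup : IsUpperSet U) (b : E)
    (h1 : ∀ p ∈ U, b ∈ W p) (hU' : U'.OrdConnected) (hup' : IsUpperSet U')
    (c : E →ₗ[k] k) (h2 : ∀ p, p ∉ U' → ∀ x ∈ W p, c x = 0)
    (p : P) (x : indSub k U p) :
    Subtype.val (((inj W hW U hU hup b h1 ≫ prj W hW U' hU' hup' c h2).app p).hom x :
      indSub k U' p) = x * c b := c.map_smul (x : k) b

theorem sum_app_val {J : Type} (s : Finset J) (f : J → (subFun W hW ⟶ subFun W hW)) (p : P)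
    (x : W p) :
    Subtype.val (((∑ j ∈ s, f j).app p).hom x : W p)
      = ∑ j ∈ s, Subtype.val (((f j).app p).hom x : W p) := by
  induction s using Finset.induction_on with
  | empty => rfl
  | insert a s ha ih =>
    rw [Finset.sum_insert ha, Finset.sum_insert ha, ← ih]
    rfl

theorem subFun_decomp {J : Type} [Fintype J] (U : J → Set P) (b : J → E) (c : J → E →ₗ[k] k)
    (hup : ∀ j, IsUpperSet (U j))
    (hT : ∀ _ : P, ∃ T : P, ∀ q : P, q ≤ T)
    (h1 : ∀ j, ∀ p ∈ U j, b j ∈ W p)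
    (h2 : ∀ j, ∀ p, p ∉ U j → ∀ x ∈ W p, c j x = 0)
    (h3 : ∀ i j, c i (b j) = if i = j then 1 else 0)
    (h4 : ∀ x, ∑ j, c j x • b j = x) : IntervalDecomposable k (subFun W hW) := by
  have hint : ∀ i : {j // (U j).Nonempty}, IsInterval (U i) := by
    rintro ⟨j, hj⟩
    refine ⟨hj, (hup j).ordConnected, ?_⟩
    intro p hp q hq
    obtain ⟨T, hT⟩ := hT p
    exact (Relation.ReflTransGen.single ⟨hp, hup j (hT p) hp, Or.inl (hT p)⟩).tail
      ⟨hup j (hT p) hp, hq, Or.inr (hT q)⟩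
  let ii := fun i : {j // (U j).Nonempty} =>
    inj W hW (U i) (hint i).2.1 (hup i) (b i) (h1 i)
  let pp := fun i : {j // (U j).Nonempty} =>
    prj W hW (U i) (hint i).2.1 (hup i) (c i) (h2 i)
  have hip : ∀ i, ii i ≫ pp i = 𝟙 _ := by
    intro i
    ext p : 2
    refine ModuleCat.hom_ext (LinearMap.ext fun x => Subtype.ext ?_)
    refine (inj_prj W hW _ _ _ _ _ _ _ _ _ _ p x).trans ?_
    rw [h3, if_pos rfl, mul_one]; rfl
  have hip0 : ∀ i j, i ≠ j → ii i ≫ pp j = 0 := by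
    intro i j hij
    ext p : 2
    refine ModuleCat.hom_ext (LinearMap.ext fun x => Subtype.ext ?_)
    refine (inj_prj W hW _ _ _ _ _ _ _ _ _ _ p x).trans ?_
    rw [h3, if_neg (fun h => hij (Subtype.ext h.symm)), mul_zero]; rfl
  have htot : ∑ i, pp i ≫ ii i = 𝟙 (subFun W hW) := by
    ext p : 2
    refine ModuleCat.hom_ext (LinearMap.ext fun x => Subtype.ext ?_)
    refine (sum_app_val W hW _ _ p x).trans ?_
    have : ∀ i, Subtype.val (((pp i ≫ ii i).app p).hom x : W p) = c i x.1 • b i :=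
      fun i => prj_inj W hW _ _ _ _ _ _ _ p x
    rw [Finset.sum_congr rfl (fun i _ => this i)]
    refine Eq.trans ?_ (h4 x.1)
    have key : ∀ x : W p, ∑ i : {j // (U j).Nonempty}, c i x.1 • b i = ∑ j, c j x.1 • b j := by
      intro x
      rw [← Finset.sum_subtype (Finset.univ.filter (fun j => (U j).Nonempty)) (by simp)
        (fun j => c j x.1 • b j)]
      refine Finset.sum_subset (Finset.subset_univ _) fun j _ hj => ?_
      rw [h2 j p (fun h => hj (by simpa using ⟨p, h⟩)) x.1 x.2, zero_smul]
    exact key x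
  refine ⟨{j // (U j).Nonempty}, fun i => U i, hint, ⟨?_⟩⟩
  refine ⟨∑ i, pp i ≫ Sigma.ι (fun i : {j // (U j).Nonempty} =>
      indicator k (U i) (hint i).2.1) i, Sigma.desc ii, ?_, ?_⟩
  · rw [Preadditive.sum_comp]
    simp only [Category.assoc, Sigma.ι_desc]
    exact htot
  · refine Sigma.hom_ext _ _ fun i => ?_
    rw [← Category.assoc, Sigma.ι_desc, Preadditive.comp_sum, Finset.sum_eq_single i]
    · rw [← Category.assoc, hip]; simp
    · intro j _ hj
      rw [← Category.assoc, hip0 i j hj.symm, zero_comp]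
    · simp

end Sum

section Kan
variable {k : Type} [Field k] {E : Type} [AddCommGroup E] [Module k E] {D R : Type} [Preorder D]
  [Preorder R] (V : D → Submodule k E) (hV : Monotone V) {f : D → R} (hf : Monotone f)
  (t : D) (hft : ∀ p, p ≤ f t)

theorem gen_nat (W : R → Submodule k E) (hW : Monotone W) (G : PersistenceModule k R)
    (m : G ⟶ subFun W hW) {p q : R} (h : p ≤ q) (x : G.obj p) :
    Subtype.val ((m.app q).hom (rho k G h x) : W q) = Subtype.val ((m.app p).hom x : W p) := by
  have nat := m.naturality (homOfLE h)
  exact congrArg (fun u => Subtype.val (u.hom x : W q)) nat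

def Lsub (f : D → R) (p : R) : Submodule k E :=
  ⨅ i : D, ⨅ _ : p ≤ f i, V i

theorem Lsub_le {p : R} {i : D} (h : p ≤ f i) : Lsub V f p ≤ V i := iInf₂_le i h

theorem Lsub_mono : Monotone (Lsub V f) := by
  intro p q h
  exact le_iInf₂ fun i hi => Lsub_le V (h.trans hi)

def Lcounit : hf.functor ⋙ subFun (Lsub V f) (Lsub_mono V) ⟶ subFun V hV where
  app i := ModuleCat.ofHom (Submodule.inclusion (Lsub_le V (le_refl (f i))))
  naturality _ _ _ := rfl

theorem rho_rho_s15 (G : PersistenceModule k R) {p q r : R} (h : p ≤ q) (h' : q ≤ r)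
    (x : G.obj p) : rho k G h' (rho k G h x) = rho k G (h.trans h') x := by
  have := G.map_comp (homOfLE h) (homOfLE h')
  exact (congrArg (fun u => u.hom x) this).symm

theorem rho_self_s15 (G : PersistenceModule k R) {p : R} (h : p ≤ p)
    (x : G.obj p) : rho k G h x = x := by
  have := G.map_id p
  exact congrArg (fun u => u.hom x) this

/-- Components of the counit, on underlying vectors. -/
def bl (G : PersistenceModule k R) (β : hf.functor ⋙ G ⟶ subFun V hV) (i : D) :
    G.obj (f i) →ₗ[k] V i := (β.app i).hom

theorem bl_nat (G : PersistenceModule k R) (β : hf.functor ⋙ G ⟶ subFun V hV) {i j : D}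
    (h : i ≤ j) (y : G.obj (f i)) :
    (bl V hV hf G β j (rho k G (hf h) y) : E) = bl V hV hf G β i y := by
  have nat := β.naturality (homOfLE h)
  exact congrArg (fun u => Subtype.val (u.hom y : V j)) nat

/-- The comparison map into the extension, on underlying vectors. -/
def liftLin (G : PersistenceModule k R)
    (β : hf.functor ⋙ G ⟶ subFun V hV) (p : R) : G.obj p →ₗ[k] E :=
  (V t).subtype ∘ₗ bl V hV hf G β t ∘ₗ rho k G (hft p)

theorem liftLin_apply (G : PersistenceModule k R)
    (β : hf.functor ⋙ G ⟶ subFun V hV) (p : R) (x : G.obj p) :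
    liftLin V hV hf t hft G β p x = (bl V hV hf G β t (rho k G (hft p) x) : E) := rfl

theorem liftLin_eq (ht : ∀ i, i ≤ t) (G : PersistenceModule k R)
    (β : hf.functor ⋙ G ⟶ subFun V hV) (p : R) (i : D)
    (h : p ≤ f i) (x : G.obj p) :
    liftLin V hV hf t hft G β p x = (bl V hV hf G β i (rho k G h x) : E) := by
  rw [← bl_nat V hV hf G β (ht i), rho_rho_s15, liftLin_apply]

theorem liftLin_rho (G : PersistenceModule k R)
    (β : hf.functor ⋙ G ⟶ subFun V hV) (p q : R) (h : p ≤ q) (x : G.obj p) :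
    liftLin V hV hf t hft G β q (rho k G h x) = liftLin V hV hf t hft G β p x := by
  rw [liftLin_apply, liftLin_apply, rho_rho_s15]

theorem liftLin_mem (ht : ∀ i, i ≤ t) (G : PersistenceModule k R)
    (β : hf.functor ⋙ G ⟶ subFun V hV) (p : R) (x : G.obj p) :
    liftLin V hV hf t hft G β p x ∈ Lsub V f p := by
  rw [Lsub, Submodule.mem_iInf]
  intro i
  rw [Submodule.mem_iInf]
  intro h
  rw [liftLin_eq V hV hf t hft ht G β p i h x]
  exact Subtype.property _

def lift (ht : ∀ i, i ≤ t) (G : PersistenceModule k R)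
    (β : hf.functor ⋙ G ⟶ subFun V hV) :
    G ⟶ subFun (Lsub V f) (Lsub_mono V) where
  app p := ModuleCat.ofHom ((liftLin V hV hf t hft G β p).codRestrict (Lsub V f p)
    (liftLin_mem V hV hf t hft ht G β p))
  naturality p q g := ModuleCat.hom_ext (LinearMap.ext fun x => Subtype.ext
    (liftLin_rho V hV hf t hft G β p q (leOfHom g) x))

theorem lift_fac (ht : ∀ i, i ≤ t) (G : PersistenceModule k R)
    (β : hf.functor ⋙ G ⟶ subFun V hV) :
    Functor.whiskerLeft hf.functor (lift V hV hf t hft ht G β) ≫ Lcounit V hV hf = β := by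
  refine NatTrans.ext (funext fun i => ?_)
  refine ModuleCat.hom_ext (LinearMap.ext fun x => Subtype.ext ?_)
  refine (liftLin_eq V hV hf t hft ht G β _ i le_rfl x).trans ?_
  exact congrArg (fun y => (bl V hV hf G β i y : E)) (rho_self_s15 G le_rfl x)

/-- Components of a morphism to the extension. -/
def ml (G : PersistenceModule k R) (m : G ⟶ subFun (Lsub V f) (Lsub_mono V)) (p : R) :
    G.obj p →ₗ[k] Lsub V f p := (m.app p).hom

theorem ml_nat (G : PersistenceModule k R) (m : G ⟶ subFun (Lsub V f) (Lsub_mono V)) {p q : R}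
    (h : p ≤ q) (x : G.obj p) : (ml V G m q (rho k G h x) : E) = ml V G m p x :=
  gen_nat (Lsub V f) (Lsub_mono V) G m h x

theorem ml_bl (G : PersistenceModule k R) (m : G ⟶ subFun (Lsub V f) (Lsub_mono V)) (i : D)
    (x : G.obj (f i)) :
    (bl V hV hf G (Functor.whiskerLeft hf.functor m ≫ Lcounit V hV hf) i x : E) =
      ml V G m (f i) x := rfl

theorem lift_uniq (ht : ∀ i, i ≤ t) (G : PersistenceModule k R)
    (β : hf.functor ⋙ G ⟶ subFun V hV) (m : G ⟶ subFun (Lsub V f) (Lsub_mono V))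
    (hm : Functor.whiskerLeft hf.functor m ≫ Lcounit V hV hf = β) :
    m = lift V hV hf t hft ht G β := by
  refine NatTrans.ext (funext fun p => ?_)
  refine ModuleCat.hom_ext (LinearMap.ext fun x => Subtype.ext ?_)
  have key : (ml V G m p x : E) = liftLin V hV hf t hft G β p x := by
    rw [liftLin_apply, ← hm, ml_bl, ml_nat]
  exact key

theorem Lsub_isRan (ht : ∀ i, i ≤ t) (hft : ∀ p, p ≤ f t) :
    (subFun (Lsub V f) (Lsub_mono V)).IsRightKanExtension (Lcounit V hV hf) where
  nonempty_isUniversal := ⟨IsTerminal.ofUniqueHom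
    (fun X => CostructuredArrow.homMk (lift V hV hf t hft ht X.left X.hom)
      (lift_fac V hV hf t hft ht X.left X.hom))
    (fun X m => CostructuredArrow.hom_ext _ _
      (lift_uniq V hV hf t hft ht X.left X.hom m.left (CostructuredArrow.w m)))⟩

theorem ranIso (ht : ∀ i, i ≤ t) (hft : ∀ p, p ≤ f t) :
    Nonempty (ranAlong k hf (subFun V hV) ≅ subFun (Lsub V f) (Lsub_mono V)) := by
  have := Lsub_isRan V hV hf t ht hft
  exact ⟨Functor.rightKanExtensionUnique _ (hf.functor.ranCounit.app (subFun V hV)) _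
    (Lcounit V hV hf)⟩

theorem restrict_dec {Q : Type} [Preorder Q] {M : PersistenceModule k R} (W : R → Submodule k E)
    (hW : Monotone W) (e : M ≅ subFun W hW) {r : Q → R} (hr : Monotone r)
    (h : IntervalDecomposable k (subFun (fun q => W (r q)) (fun _ _ h => hW (hr h)))) :
    IntervalDecomposable k (restrictAlong k hr M) :=
  intervalDecomposable_of_iso (Functor.isoWhiskerLeft hr.functor e) h

end Kan

section NotDec
variable {k : Type} [Field k] {E : Type} [AddCommGroup E] [Module k E] {P : Type} [Preorder P]
  (W : P → Submodule k E) (hW : Monotone W) (T : P) 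

/-- The inclusion into the constant module. -/
def toConst : subFun W hW ⟶ (Functor.const P).obj (ModuleCat.of k E) where
  app p := ModuleCat.ofHom (W p).subtype
  naturality _ _ _ := rfl

theorem not_dec (hT : ∀ p, p ≤ T) (hTtop : W T = ⊤)
    (hend : ∀ g : E →ₗ[k] E, (∀ p, ∀ x ∈ W p, g x ∈ W p) → ∃ μ : k, ∀ x, g x = μ • x)
    (hdim : ∀ π : E →ₗ[k] k, ∃ x, x ≠ 0 ∧ π x = 0) :
    ¬ IntervalDecomposable k (subFun W hW) := by
  rintro ⟨ι, I, hI, ⟨e⟩⟩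
  let F := fun i => indicator k (I i) (hI i).2.1
  let ii : ∀ i, F i ⟶ subFun W hW := fun i => Sigma.ι F i ≫ e.inv
  let pp : ∀ i, subFun W hW ⟶ F i := fun i => e.hom ≫ Sigma.π F i
  have hid : ∀ i, ii i ≫ pp i = 𝟙 _ := by
    intro i
    simp [ii, pp, Sigma.ι_π_eq_id]
  let tt : E →ₗ[k] W T := LinearMap.codRestrict (W T) LinearMap.id (by simp [hTtop])
  have hval : ∀ (u : subFun W hW ⟶ subFun W hW) (p : P) (x : W p),
      Subtype.val ((u.app p).hom x : W p) =
        Subtype.val ((u.app T).hom (tt x.1) : W T) := by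
    intro u p x
    have nat := u.naturality (homOfLE (hT p))
    have := congrArg (fun g => Subtype.val (g.hom x : W T)) nat
    exact this.symm
  have hpp : ∀ i, (pp i ≫ ii i).app T = 0 := by
    intro i
    let g : E →ₗ[k] E := (W T).subtype ∘ₗ
      (((pp i ≫ ii i).app T).hom : W T →ₗ[k] W T) ∘ₗ tt
    obtain ⟨μ, hμ⟩ := hend g (by
      intro p x hx
      have := hval (pp i ≫ ii i) p ⟨x, hx⟩
      show Subtype.val (((pp i ≫ ii i).app T).hom (tt x) : W T) ∈ _
      rw [← this]
      exact Subtype.property _)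
    let π : E →ₗ[k] k := (indSub k (I i) T).subtype ∘ₗ
      (((pp i).app T).hom : W T →ₗ[k] indSub k (I i) T) ∘ₗ tt
    obtain ⟨x, hx0, hx⟩ := hdim π
    have hx' : (((pp i).app T).hom : W T →ₗ[k] indSub k (I i) T) (tt x) = 0 := Subtype.ext hx
    have hg : g x = 0 := by
      show Subtype.val (((ii i).app T).hom (((pp i).app T).hom (tt x)) : W T) = 0
      erw [hx', map_zero]
      rfl
    have hμ0 : μ = 0 := by
      rw [hμ] at hg
      exact (smul_eq_zero.mp hg).resolve_right hx0
    refine ModuleCat.hom_ext (LinearMap.ext fun y => Subtype.ext ?_)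
    have h1 : g y.1 = 0 := by rw [hμ, hμ0, zero_smul]
    exact h1
  have hii : ∀ i, (ii i).app T = 0 := by
    intro i
    have : ii i = ii i ≫ (pp i ≫ ii i) := by rw [← Category.assoc, hid, Category.id_comp]
    rw [this, NatTrans.comp_app, hpp, comp_zero]
  have hz : e.inv ≫ toConst W hW = 0 := by
    refine Sigma.hom_ext _ _ fun i => ?_
    rw [comp_zero, ← Category.assoc]
    show ii i ≫ toConst W hW = 0
    ext p : 2
    have nat := (ii i ≫ toConst W hW).naturality (homOfLE (hT p))
    rw [NatTrans.comp_app (ii i) _ T, hii, zero_comp, comp_zero] at nat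
    exact nat.symm
  have hz' : toConst W hW = 0 := by
    rw [← cancel_epi e.inv, hz, comp_zero]
  obtain ⟨x, hx0, -⟩ := hdim 0
  have := congrArg (fun u => (u.app T).hom (tt x)) hz'
  exact hx0 this

end NotDec

section Comb
variable {k : Type} [Field k] {n : ℕ}

def ext0 (j : Fin (n + 1)) : (Fin n → k) →ₗ[k] k where
  toFun x := if h : j.1 < n then x ⟨j.1, h⟩ else 0
  map_add' x y := by split_ifs <;> simp
  map_smul' c x := by split_ifs <;> simp

theorem ext0_apply (j : Fin (n + 1)) (x : Fin n → k) :
    ext0 j x = if h : j.1 < n then x ⟨j.1, h⟩ else 0 := rfl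

def vv (k : Type) [Field k] (j : Fin (n + 1)) : Fin n → k :=
  if h : j.1 < n then Pi.single ⟨j.1, h⟩ 1 else -1

theorem ext0_castSucc (j : Fin n) (x : Fin n → k) : ext0 j.castSucc x = x j := by
  simp [ext0_apply]
theorem ext0_last (x : Fin n → k) : ext0 (Fin.last n) x = 0 := by
  simp [ext0_apply]
theorem vv_castSucc (j : Fin n) : vv k j.castSucc = Pi.single j 1 := by
  simp [vv]
theorem vv_last : vv k (Fin.last n) = -1 := by
  simp [vv]

theorem ext0_sub_vv (i j a : Fin (n + 1)) :
    ext0 j (vv k i) - ext0 a (vv k i) = (if j = i then 1 else 0) - (if a = i then 1 else 0) := by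
  induction i using Fin.lastCases <;> induction j using Fin.lastCases <;>
    induction a using Fin.lastCases <;>
    simp [ext0_castSucc, ext0_last, vv_castSucc, vv_last, Pi.single_apply,
      Fin.castSucc_ne_last, (Fin.castSucc_ne_last _).symm]

theorem ext0_sum (a : Fin (n + 1)) (x : Fin n → k) :
    ∑ j, (ext0 j x - ext0 a x) • vv k j = x := by
  simp only [sub_smul, Finset.sum_sub_distrib, ← Finset.smul_sum]
  rw [Fin.sum_univ_castSucc, Fin.sum_univ_castSucc]
  ext m
  simp [ext0_castSucc, ext0_last, vv_castSucc, vv_last, Pi.single_apply]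

theorem ext0_of_mem_span {i j a : Fin (n + 1)} (hj : j ≠ i) (ha : a ≠ i) {x : Fin n → k}
    (hx : x ∈ Submodule.span k {vv k i}) : ext0 j x = ext0 a x := by
  obtain ⟨s, rfl⟩ := Submodule.mem_span_singleton.mp hx
  have := ext0_sub_vv (k := k) i j a
  rw [if_neg hj, if_neg ha, sub_zero, sub_eq_zero] at this
  rw [map_smul, map_smul, this]

def minD (i : Fin (n + 1)) : DPos n := i.castSucc

theorem minD_ne (i : Fin (n + 1)) : minD i ≠ Fin.last (n + 1) := Fin.castSucc_ne_last i

theorem Vsub_eq (i : Fin (n + 1)) :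
    Vsub k n (minD i) = Submodule.span k {vv k i} := by
  rw [Vsub, if_neg (minD_ne i), vv]
  by_cases h : i.1 < n
  · rw [dif_pos (show Fin.val (n := n + 2) (minD i) < n from h), dif_pos h]; rfl
  · rw [dif_neg (show ¬ Fin.val (n := n + 2) (minD i) < n from h), dif_neg h]
    rw [← Set.neg_singleton, Submodule.span_neg]; rfl

theorem phi_castSucc (i : Fin (n + 1)) :
    phi n (minD i) = (i, ⟨n - i.1, by omega⟩) := by
  rw [phi, dif_neg (minD_ne i)]; rfl

def topD (n : ℕ) : DPos n := Fin.last (n + 1)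

theorem phi_topD : phi n (topD n) = (Fin.last n, Fin.last n) := by
  rw [phi, dif_pos]; rfl

theorem le_phi_topD (p : Fin (n + 1) × Fin (n + 1)) : p ≤ phi n (topD n) := by
  rw [phi_topD]
  exact ⟨Fin.le_last _, Fin.le_last _⟩

theorem le_topD (i : DPos n) : i ≤ topD n := Or.inr rfl

theorem le_phi_castSucc (p : Fin (n + 1) × Fin (n + 1)) (i : Fin (n + 1)) :
    p ≤ phi n (minD i) ↔ p.1.1 ≤ i.1 ∧ p.2.1 ≤ n - i.1 := by
  rw [phi_castSucc]; rfl

/-- The supports. -/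
def UU (j : Fin (n + 1)) : Set (Fin (n + 1) × Fin (n + 1)) :=
  {p | n < p.1.1 + p.2.1 ∨ (p.1.1 = j.1 ∧ p.1.1 + p.2.1 = n)}

theorem mem_UU (j : Fin (n + 1)) (p : Fin (n + 1) × Fin (n + 1)) :
    p ∈ UU j ↔ n < p.1.1 + p.2.1 ∨ (p.1.1 = j.1 ∧ p.1.1 + p.2.1 = n) := Iff.rfl

theorem D_cases (i : DPos n) : i = topD n ∨ ∃ j, i = minD j := by
  by_cases h : i = topD n
  · exact Or.inl h
  · exact Or.inr ⟨Fin.castPred (n := n + 1) i h, rfl⟩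

theorem Vsub_top : Vsub k n (topD n) = ⊤ := by
  rw [Vsub, if_pos]; rfl

theorem UU_upper (j : Fin (n + 1)) : IsUpperSet (UU j) := by
  intro p q h hp
  have h1 : p.1.1 ≤ q.1.1 := h.1
  have h2 : p.2.1 ≤ q.2.1 := h.2
  rw [mem_UU] at hp ⊢
  omega

theorem vv_mem (j : Fin (n + 1)) (p) (hp : p ∈ UU j) :
    vv k j ∈ Lsub (Vsub k n) (phi n) p := by
  rw [Lsub, Submodule.mem_iInf]
  intro i
  rw [Submodule.mem_iInf]
  intro h
  rcases D_cases i with rfl | ⟨i, rfl⟩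
  · rw [Vsub_top]; trivial
  · rw [le_phi_castSucc] at h
    have : i = j := by
      rw [mem_UU] at hp
      apply Fin.ext
      omega
    rw [this, Vsub_eq]
    exact Submodule.mem_span_singleton_self _

theorem coord_zero (hn : 2 ≤ n) (j a : Fin (n + 1)) (p : Fin (n + 1) × Fin (n + 1))
    (hpa : ¬ (p.1.1 = a.1 ∧ p.1.1 + p.2.1 = n)) (hp : p ∉ UU j) (x : Fin n → k)
    (hx : x ∈ Lsub (Vsub k n) (phi n) p) : ext0 j x - ext0 a x = 0 := by
  rw [mem_UU, not_or] at hp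
  have key : ∀ i : Fin (n + 1), p.1.1 ≤ i.1 → p.2.1 ≤ n - i.1 → ∀ j a : Fin (n + 1),
      j ≠ i → a ≠ i → ext0 j x = ext0 a x := by
    intro i h1 h2 j a hj ha
    refine ext0_of_mem_span hj ha ?_
    rw [← Vsub_eq]
    exact Lsub_le _ ((le_phi_castSucc p i).mpr ⟨h1, h2⟩) hx
  rw [sub_eq_zero]
  by_cases hs : p.1.1 + p.2.1 = n
  · refine key p.1 le_rfl (by omega) j a ?_ ?_
    · rintro rfl; exact hp.2 ⟨rfl, hs⟩
    · rintro rfl; exact hpa ⟨rfl, hs⟩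
  · have hlt : p.1.1 + 1 < n + 1 := by omega
    have k1 := key p.1 le_rfl (by omega)
    have k2 := key ⟨p.1.1 + 1, hlt⟩ (by simp) (by simp; omega)
    obtain ⟨m, hm1, hm2⟩ : ∃ m : Fin (n + 1), m ≠ p.1 ∧ m ≠ ⟨p.1.1 + 1, hlt⟩ := by
      by_cases h0 : p.1.1 = 0
      · exact ⟨⟨2, by omega⟩, Fin.ne_of_val_ne (by show 2 ≠ p.1.1; omega),
          Fin.ne_of_val_ne (by show 2 ≠ p.1.1 + 1; omega)⟩
      · exact ⟨⟨0, by omega⟩, Fin.ne_of_val_ne (by show 0 ≠ p.1.1; omega),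
          Fin.ne_of_val_ne (by show 0 ≠ p.1.1 + 1; omega)⟩
    have hm : ∀ j, ext0 j x = ext0 m x := by
      intro j
      by_cases hj : j = p.1
      · refine k2 j m ?_ hm2
        rw [hj]; simp [Fin.ext_iff]
      · exact k1 j m hj hm1
    rw [hm j, hm a]

theorem W_top : Lsub (Vsub k n) (phi n) (Fin.last n, Fin.last n) = ⊤ ∨ n = 0 := by
  by_cases h0 : n = 0
  · exact Or.inr h0
  left
  rw [eq_top_iff]
  intro x _
  have : x = ∑ j, (ext0 j x - ext0 0 x) • vv k j := (ext0_sum 0 x).symm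
  rw [this]
  refine Submodule.sum_mem _ fun j _ => Submodule.smul_mem _ _ (vv_mem j _ ?_)
  left
  simp; omega

theorem scalar_of_preserve (g : (Fin n → k) →ₗ[k] (Fin n → k))
    (hg : ∀ p, ∀ x ∈ Lsub (Vsub k n) (phi n) p, g x ∈ Lsub (Vsub k n) (phi n) p) :
    ∃ μ : k, ∀ x, g x = μ • x := by
  have hl : ∀ i : Fin (n + 1), ∃ s : k, g (vv k i) = s • vv k i := by
    intro i
    have h1 : vv k i ∈ Lsub (Vsub k n) (phi n) (phi n (minD i)) := by
      refine vv_mem i _ (Or.inr ?_)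
      rw [phi_castSucc]
      refine ⟨rfl, ?_⟩
      show i.1 + (n - i.1) = n
      omega
    have h2 := Lsub_le (Vsub k n) (le_refl (phi n (minD i))) (hg _ _ h1)
    rw [Vsub_eq] at h2
    obtain ⟨s, hs⟩ := Submodule.mem_span_singleton.mp h2
    exact ⟨s, hs.symm⟩
  choose s hs using hl
  have hsum : ∑ i : Fin n, vv k i.castSucc = - vv k (Fin.last n) := by
    rw [vv_last]
    ext m
    simp [vv_castSucc, Pi.single_apply]
  have h1 := congrArg g hsum
  rw [map_sum, map_neg, hs] at h1
  simp only [hs] at h1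
  have hμ : ∀ i : Fin n, s i.castSucc = s (Fin.last n) := by
    intro i
    have := congrFun h1 i
    simpa [vv_castSucc, vv_last, Pi.single_apply] using this
  refine ⟨s (Fin.last n), fun x => ?_⟩
  conv_lhs => rw [← ext0_sum (Fin.last n) x]
  conv_rhs => rw [← ext0_sum (Fin.last n) x]
  rw [map_sum, Finset.smul_sum]
  refine Finset.sum_congr rfl fun j _ => ?_
  have : s j = s (Fin.last n) := by
    induction j using Fin.lastCases with
    | last => rfl
    | cast j => exact hμ j
  rw [map_smul, hs, this, smul_comm]

theorem exists_ker (hn : 2 ≤ n) (π : (Fin n → k) →ₗ[k] k) : ∃ x, x ≠ 0 ∧ π x = 0 := by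
  by_contra! h
  have hinj : Function.Injective π := by
    rw [injective_iff_map_eq_zero]
    intro x hx
    by_contra h0
    exact h x h0 hx
  have := LinearMap.finrank_le_finrank_of_injective hinj
  simp at this
  omega

theorem ran_iso (k : Type) [Field k] (n : ℕ) :
    Nonempty (ranAlong k (phi_mono n) (Vmod k n) ≅
      subFun (Lsub (Vsub k n) (phi n)) (Lsub_mono _)) :=
  ranIso (Vsub k n) (fun _ _ h => Vsub_mono k n h) (phi_mono n) (topD n) le_topD le_phi_topD

theorem sub_dec (hn : 2 ≤ n) (a : Fin (n + 1)) {Q : Type} [Preorder Q]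
    (r : Q → Fin (n + 1) × Fin (n + 1)) (hr : Monotone r)
    (hT : ∀ _ : Q, ∃ T : Q, ∀ q : Q, q ≤ T)
    (ha : ∀ q, ¬ ((r q).1.1 = a.1 ∧ (r q).1.1 + (r q).2.1 = n)) :
    IntervalDecomposable k (subFun (fun q => Lsub (Vsub k n) (phi n) (r q))
      (fun _ _ h => Lsub_mono _ (hr h))) := by
  refine subFun_decomp _ _ (J := {j : Fin (n + 1) // j ≠ a}) (fun j => r ⁻¹' UU j.1)
    (fun j => vv k j.1) (fun j => ext0 j.1 - ext0 a) ?_ hT ?_ ?_ ?_ ?_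
  · intro j p q h hp
    exact UU_upper j.1 (hr h) hp
  · intro j p hp
    exact vv_mem j.1 _ hp
  · intro j p hp x hx
    exact coord_zero hn j.1 a (r p) (ha p) hp x hx
  · intro i j
    rw [LinearMap.sub_apply, ext0_sub_vv, if_neg (Ne.symm j.2), sub_zero]
    simp [Subtype.ext_iff]
  · intro x
    conv_rhs => rw [← ext0_sum a x]
    have := Finset.sum_subtype (F := inferInstance) (Finset.univ.filter (fun j => j ≠ a)) (p := fun j => j ≠ a)
      (by simp) (fun j : Fin (n + 1) => (ext0 j x - ext0 a x) • vv k j)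
    refine this.symm.trans ?_
    refine Finset.sum_subset (Finset.subset_univ _) fun j _ hj => ?_
    have : j = a := by simpa using hj
    rw [this]; simp

end Comb

end Helpers

/-- The pointwise right Kan extension `L_n` of `V_n` along `φ` is not
interval-decomposable, yet its restriction to every strict subgrid `X' × Y'` of
`[1,n+1]²` is interval-decomposable. -/
theorem ran_Vmod_not_intervalDecomposable_but_locally_decomposable (k : Type) [Field k]
    (n : ℕ) (hn : 2 ≤ n) :
    ¬ IntervalDecomposable k (ranAlong k (phi_mono n) (Vmod k n)) ∧
      ∀ X' Y' : Set (Fin (n + 1)), X' ×ˢ Y' ≠ Set.univ →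
        IntervalDecomposable k
          (restrictAlong k
            (show Monotone (fun p : ↥X' × ↥Y' =>
                ((p.1.1, p.2.1) : Fin (n + 1) × Fin (n + 1))) from
              fun _ _ h => ⟨h.1, h.2⟩)
            (ranAlong k (phi_mono n) (Vmod k n))) := by
  obtain ⟨e⟩ := ran_iso k n
  constructor
  · intro h
    have hT : ∀ p : Fin (n + 1) × Fin (n + 1), p ≤ (Fin.last n, Fin.last n) :=
      fun p => ⟨Fin.le_last _, Fin.le_last _⟩
    exact not_dec (Lsub (Vsub k n) (phi n)) (Lsub_mono _) (Fin.last n, Fin.last n)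
      hT (W_top.resolve_right (by omega))
      scalar_of_preserve (exists_ker hn) (intervalDecomposable_of_iso e.symm h)
  · intro X' Y' hXY
    have hr : Monotone (fun p : ↥X' × ↥Y' =>
        ((p.1.1, p.2.1) : Fin (n + 1) × Fin (n + 1))) := fun _ _ h => ⟨h.1, h.2⟩
    refine restrict_dec (Lsub (Vsub k n) (phi n)) (Lsub_mono _) e hr ?_
    have hmiss : ∃ a : Fin (n + 1), a ∉ X' ∨ (⟨n - a.1, by omega⟩ : Fin (n + 1)) ∉ Y' := by
      by_contra! hall
      apply hXY
      ext ⟨x, y⟩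
      simp only [Set.mem_prod, Set.mem_univ, iff_true]
      refine ⟨(hall x).1, ?_⟩
      have := (hall ⟨n - y.1, by omega⟩).2
      convert this using 1
      apply Fin.ext
      show y.1 = n - (n - y.1)
      omega
    obtain ⟨a, ha⟩ := hmiss
    refine sub_dec hn a _ hr ?_ ?_
    · rintro ⟨x, y⟩
      have : Nonempty X' := ⟨x⟩
      have : Nonempty Y' := ⟨y⟩
      obtain ⟨tx, htx⟩ := Finite.exists_max (fun z : X' => z.1)
      obtain ⟨ty, hty⟩ := Finite.exists_max (fun z : Y' => z.1)
      exact ⟨(tx, ty), fun q => ⟨htx q.1, hty q.2⟩⟩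
    · rintro ⟨x, y⟩ ⟨h1, h2⟩
      simp only at h1 h2
      rcases ha with ha | ha
      · apply ha
        rw [← Fin.ext h1]
        exact x.2
      · apply ha
        convert y.2 using 1
        apply Fin.ext
        show n - a.1 = y.1.1
        omega

end PersistencePaper
end
end
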